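/- arXiv:1802.04026 — 2 statements merged into one kernel-verified Lean document; each statement's English description precedes it below -/
import Mathlib

section
/- Let a₁, a₂ be polynomials with all zeros on the unit circle and k = a₂/a₁ ∈ H^∞. Then 𝔐(\bar{a₁}, \bar{a₂}) = k·(M(\bar{a₁}) ∩ H^∞): the multipliers from M(\bar{a₁}) to M(\bar{a₂}) are exactly the products kψ with ψ ∈ M(\bar{a₁}) ∩ H^∞. -/
open Complex Set

noncomputable section

/-- The open unit disk in `ℂ`. -/
def unitDisk : Set ℂ := Metric.ball 0 1

/-- The `n`-th Taylor coefficient of `f` at `0`. -/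
def coef (f : ℂ → ℂ) (n : ℕ) : ℂ := iteratedDeriv n f 0 / (n.factorial : ℂ)

/-- `f` belongs to the Hardy space `H²` of the unit disk. -/
def MemH2 (f : ℂ → ℂ) : Prop :=
  DifferentiableOn ℂ f unitDisk ∧ Summable fun n => ‖coef f n‖ ^ 2

/-- The `H²` norm. -/
def norm2 (f : ℂ → ℂ) : ℝ := Real.sqrt (∑' n, ‖coef f n‖ ^ 2)

/-- The `H²` inner product. -/
def inner2 (f g : ℂ → ℂ) : ℂ := ∑' n, coef f n * (starRingEnd ℂ) (coef g n)

/-- `f` belongs to `H^∞`: bounded and analytic on the unit disk. -/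
def MemHinf (f : ℂ → ℂ) : Prop :=
  DifferentiableOn ℂ f unitDisk ∧ ∃ C, ∀ z ∈ unitDisk, ‖f z‖ ≤ C

/-- The `H^∞` (sup) norm. -/
def normInf (f : ℂ → ℂ) : ℝ := sSup ((fun z => ‖f z‖) '' unitDisk)

/-- The co-analytic Toeplitz operator `T_{\bar a}` in terms of Taylor
coefficients: the `n`-th coefficient of `T_{\bar a} f` is
`∑ₖ conj (â k) * f̂ (n + k)`. -/
def Tbar (a f : ℂ → ℂ) : ℂ → ℂ :=
  fun z => ∑' n : ℕ, (∑' k : ℕ, (starRingEnd ℂ) (coef a k) * coef f (n + k)) * z ^ n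

/-- Membership in the range space `M(ā) = T_{\bar a} H²` (as functions on the disk). -/
def MemMbar (a g : ℂ → ℂ) : Prop :=
  ∃ f, MemH2 f ∧ Set.EqOn g (Tbar a f) unitDisk

/-- The range norm on `M(ā)`: `‖T_{\bar a} f‖_{ā} = ‖f‖_{H²}`. -/
def normMbar (a g : ℂ → ℂ) : ℝ :=
  sInf {r | ∃ f, MemH2 f ∧ Set.EqOn g (Tbar a f) unitDisk ∧ r = norm2 f}

/-- `a` is outer: the analytic Toeplitz operator `T_a` (multiplication by `a`)
has dense range in `H²`. -/
def Outer (a : ℂ → ℂ) : Prop :=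
  ∀ g, MemH2 g → ∀ ε > 0, ∃ f, MemH2 f ∧ norm2 (fun z => g z - a z * f z) < ε

/-- `u` is inner: multiplication by `u` is isometric on `H²`. -/
def IsInner (u : ℂ → ℂ) : Prop :=
  MemHinf u ∧ ∀ f, MemH2 f → norm2 (fun z => u z * f z) = norm2 f

/-- `p` is (given by) a polynomial of degree `< N`, i.e. of degree at most `N - 1`. -/
def MemPoly (N : ℕ) (p : ℂ → ℂ) : Prop :=
  ∃ q : Polynomial ℂ, q.degree < (N : WithBot ℕ) ∧ ∀ z, p z = q.eval z

/-- `φ` is a multiplier from `M(ā₁)` to `M(ā₂)`. -/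
def Mult (a₁ a₂ φ : ℂ → ℂ) : Prop :=
  DifferentiableOn ℂ φ unitDisk ∧
    ∀ f, MemMbar a₁ f → MemMbar a₂ fun z => φ z * f z

/-- The backward shift `B f = (f - f 0) / z`. -/
def Bshift (f : ℂ → ℂ) : ℂ → ℂ :=
  fun z => if z = 0 then deriv f 0 else (f z - f 0) / z

namespace Hardy

open Filter Topology PowerSeries

/-- The sum of a power series at a point of the disk. -/
def evalSeries (F : PowerSeries ℂ) (z : ℂ) : ℂ := ∑' n, coeff n F * z ^ n

/-- The power series converges absolutely at every point of the unit disk. -/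
def ConvDisk (F : PowerSeries ℂ) : Prop :=
  ∀ z ∈ unitDisk, Summable fun n => ‖coeff n F * z ^ n‖

/-- The coefficients of the power series are square summable. -/
def SqSummable (F : PowerSeries ℂ) : Prop := Summable fun n => ‖coeff n F‖ ^ 2

lemma mem_unitDisk {z : ℂ} : z ∈ unitDisk ↔ ‖z‖ < 1 := by
  simp [unitDisk]

section Conv

variable {F G : PowerSeries ℂ} {z : ℂ}

lemma ConvDisk.hasSum (hF : ConvDisk F) (hz : z ∈ unitDisk) :
    HasSum (fun n => coeff n F * z ^ n) (evalSeries F z) :=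
  (hF z hz).of_norm.hasSum

lemma ConvDisk.add (hF : ConvDisk F) (hG : ConvDisk G) : ConvDisk (F + G) := by
  intro z hz
  refine ((hF z hz).add (hG z hz)).of_nonneg_of_le (fun _ => norm_nonneg _) fun n => ?_
  rw [map_add, add_mul]
  exact norm_add_le _ _

lemma ConvDisk.evalSeries_add (hF : ConvDisk F) (hG : ConvDisk G) (hz : z ∈ unitDisk) :
    evalSeries (F + G) z = evalSeries F z + evalSeries G z := by
  refine HasSum.tsum_eq ?_
  simpa [add_mul] using (hF.hasSum hz).add (hG.hasSum hz)

lemma coeff_mul_mul_pow (F G : PowerSeries ℂ) (z : ℂ) (n : ℕ) :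
    coeff n (F * G) * z ^ n =
      ∑ p ∈ Finset.HasAntidiagonal.antidiagonal n, coeff p.1 F * z ^ p.1 * (coeff p.2 G * z ^ p.2) := by
  rw [coeff_mul, Finset.sum_mul]
  refine Finset.sum_congr rfl fun p hp => ?_
  rw [← Finset.HasAntidiagonal.mem_antidiagonal.1 hp, pow_add]
  ring

lemma ConvDisk.mul (hF : ConvDisk F) (hG : ConvDisk G) : ConvDisk (F * G) := by
  intro z hz
  have h := summable_norm_sum_mul_antidiagonal_of_summable_norm (f := fun n => coeff n F * z ^ n)
    (g := fun n => coeff n G * z ^ n) (hF z hz) (hG z hz)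
  exact h.congr fun n => by rw [coeff_mul_mul_pow]

lemma ConvDisk.evalSeries_mul (hF : ConvDisk F) (hG : ConvDisk G) (hz : z ∈ unitDisk) :
    evalSeries (F * G) z = evalSeries F z * evalSeries G z := by
  simp only [evalSeries, coeff_mul_mul_pow]
  exact (tsum_mul_tsum_eq_tsum_sum_antidiagonal_of_summable_norm (hF z hz) (hG z hz)).symm

lemma convDisk_coe (P : Polynomial ℂ) : ConvDisk P := by
  intro z _
  refine summable_of_ne_finset_zero (s := P.support) fun n hn => ?_
  simp [Polynomial.notMem_support_iff.1 hn]

lemma evalSeries_coe (P : Polynomial ℂ) (z : ℂ) : evalSeries P z = P.eval z := by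
  rw [evalSeries, tsum_eq_sum (s := P.support), Polynomial.eval_eq_sum, Polynomial.sum]
  · simp
  · intro n hn
    simp [Polynomial.notMem_support_iff.1 hn]

lemma ConvDisk.hasFPowerSeriesOnBall (hF : ConvDisk F) :
    HasFPowerSeriesOnBall (evalSeries F)
      (FormalMultilinearSeries.ofScalars ℂ fun n => coeff n F) 0 1 where
  r_le := by
    refine ENNReal.le_of_forall_nnreal_lt fun r hr => ?_
    refine FormalMultilinearSeries.le_radius_of_summable_norm _ ?_
    have hr' : ((r : ℝ) : ℂ) ∈ unitDisk := by
      rw [mem_unitDisk]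
      simpa using hr
    simpa [FormalMultilinearSeries.ofScalars_norm] using hF _ hr'
  r_pos := one_pos
  hasSum := by
    intro y hy
    have hy' : y ∈ unitDisk := by
      rw [mem_unitDisk]
      simpa [enorm_eq_nnnorm, ← NNReal.coe_lt_coe] using hy
    simpa [mul_comm] using hF.hasSum hy'

lemma ConvDisk.differentiableOn (hF : ConvDisk F) : DifferentiableOn ℂ (evalSeries F) unitDisk := by
  have h := hF.hasFPowerSeriesOnBall.differentiableOn
  rwa [← ENNReal.ofReal_one, Metric.eball_ofReal] at h

lemma ConvDisk.coef_eq (hF : ConvDisk F) {f : ℂ → ℂ} (h : EqOn f (evalSeries F) unitDisk)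
    (n : ℕ) : coef f n = coeff n F := by
  have hev : evalSeries F =ᶠ[𝓝 0] f := by
    filter_upwards [Metric.isOpen_ball.mem_nhds (Metric.mem_ball_self one_pos)] with z hz
    exact (h hz).symm
  have h1 := hF.hasFPowerSeriesOnBall.hasFPowerSeriesAt.congr hev
  have h2 := h1.analyticAt.hasFPowerSeriesAt.eq_formalMultilinearSeries h1
  have h3 := congrArg (fun p => FormalMultilinearSeries.coeff p n) h2
  rwa [FormalMultilinearSeries.coeff_ofScalars, FormalMultilinearSeries.coeff_ofScalars] at h3

lemma ConvDisk.ext (hF : ConvDisk F) (hG : ConvDisk G)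
    (h : EqOn (evalSeries F) (evalSeries G) unitDisk) : F = G := by
  ext n
  rw [← hF.coef_eq (fun _ _ => rfl), hG.coef_eq h]

/-- The Taylor series at the origin. -/
def taylor (f : ℂ → ℂ) : PowerSeries ℂ := PowerSeries.mk (coef f)

lemma convDisk_taylor {f : ℂ → ℂ} (hf : DifferentiableOn ℂ f unitDisk) : ConvDisk (taylor f) := by
  intro z hz
  have h := (Complex.hasSum_taylorSeries_on_ball hf hz).summable.norm
  refine h.congr fun n => ?_
  simp only [taylor, coeff_mk, coef, sub_zero, smul_eq_mul]
  congr 1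
  ring

lemma eqOn_evalSeries_taylor {f : ℂ → ℂ} (hf : DifferentiableOn ℂ f unitDisk) :
    EqOn f (evalSeries (taylor f)) unitDisk := by
  intro z hz
  rw [evalSeries, ← (Complex.hasSum_taylorSeries_on_ball hf hz).tsum_eq]
  refine tsum_congr fun n => ?_
  simp only [taylor, coeff_mk, coef, sub_zero, smul_eq_mul]
  ring

lemma ConvDisk.taylor_eq (hF : ConvDisk F) {f : ℂ → ℂ} (h : EqOn f (evalSeries F) unitDisk) :
    taylor f = F := by
  ext n
  rw [taylor, coeff_mk, hF.coef_eq h]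

end Conv

section SqSummable

variable {F G : PowerSeries ℂ} {z : ℂ}

lemma SqSummable.add (hF : SqSummable F) (hG : SqSummable G) : SqSummable (F + G) := by
  refine ((Summable.add hF hG).mul_left 2).of_nonneg_of_le (fun _ => by positivity) fun n => ?_
  rw [map_add]
  nlinarith [norm_add_le (coeff n F) (coeff n G), norm_nonneg (coeff n F + coeff n G),
    sq_nonneg (‖coeff n F‖ - ‖coeff n G‖)]

lemma SqSummable.C_mul (c : ℂ) (hF : SqSummable F) : SqSummable (C c * F) := by
  refine (Summable.mul_left (‖c‖ ^ 2) hF).congr fun n => ?_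
  rw [coeff_C_mul, norm_mul, mul_pow]

lemma SqSummable.X_mul (hF : SqSummable F) : SqSummable (X * F) := by
  rw [SqSummable, ← summable_nat_add_iff 1]
  simpa [coeff_succ_X_mul, SqSummable] using hF

lemma SqSummable.coe_mul (P : Polynomial ℂ) (hF : SqSummable F) :
    SqSummable ((P : PowerSeries ℂ) * F) := by
  induction P using Polynomial.induction_on' with
  | add p q hp hq => rw [Polynomial.coe_add, add_mul]; exact hp.add hq
  | monomial n a =>
    rw [← Polynomial.C_mul_X_pow_eq_monomial, Polynomial.coe_mul, Polynomial.coe_C, mul_assoc]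
    refine SqSummable.C_mul a ?_
    induction n with
    | zero => simpa using hF
    | succ n ih =>
      rw [pow_succ', Polynomial.coe_mul, Polynomial.coe_X, mul_assoc]
      exact ih.X_mul

lemma sqSummable_coe (P : Polynomial ℂ) : SqSummable (P : PowerSeries ℂ) := by
  refine summable_of_ne_finset_zero (s := P.support) fun n hn => ?_
  simp [Polynomial.notMem_support_iff.1 hn]

lemma SqSummable.shift (hF : SqSummable F) (N : ℕ) :
    SqSummable (PowerSeries.mk fun i => coeff (i + N) F) := by
  simpa [SqSummable] using (summable_nat_add_iff N).2 hF

lemma SqSummable.convDisk (hF : SqSummable F) : ConvDisk F := by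
  intro z hz
  rw [mem_unitDisk] at hz
  have h2 : Summable fun n : ℕ => (‖z‖ ^ 2) ^ n :=
    summable_geometric_of_lt_one (by positivity) (by nlinarith [norm_nonneg z])
  refine (Summable.add hF h2).of_nonneg_of_le (fun _ => norm_nonneg _) fun n => ?_
  rw [norm_mul, norm_pow, ← pow_mul, mul_comm 2 n, pow_mul]
  nlinarith [sq_nonneg (‖coeff n F‖ - ‖z‖ ^ n), sq_nonneg ‖coeff n F‖, sq_nonneg (‖z‖ ^ n)]

/-- The reproducing kernel estimate. -/
lemma SqSummable.norm_evalSeries_sq_le (hF : SqSummable F) (hz : z ∈ unitDisk) :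
    ‖evalSeries F z‖ ^ 2 ≤ (∑' n, ‖coeff n F‖ ^ 2) * (1 - ‖z‖ ^ 2)⁻¹ := by
  have hz' := mem_unitDisk.1 hz
  have hgeo : HasSum (fun n : ℕ => (‖z‖ ^ 2) ^ n) (1 - ‖z‖ ^ 2)⁻¹ :=
    hasSum_geometric_of_lt_one (by positivity) (by nlinarith [norm_nonneg z])
  have hlim := ((hF.convDisk.hasSum hz).tendsto_sum_nat.norm).pow 2
  refine le_of_tendsto' hlim fun N => ?_
  calc ‖∑ n ∈ Finset.range N, coeff n F * z ^ n‖ ^ 2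
      ≤ (∑ n ∈ Finset.range N, ‖coeff n F‖ * ‖z‖ ^ n) ^ 2 := by
        gcongr
        refine (norm_sum_le _ _).trans (le_of_eq ?_)
        simp
    _ ≤ (∑ n ∈ Finset.range N, ‖coeff n F‖ ^ 2) * ∑ n ∈ Finset.range N, (‖z‖ ^ n) ^ 2 :=
        Finset.sum_mul_sq_le_sq_mul_sq _ _ _
    _ ≤ (∑' n, ‖coeff n F‖ ^ 2) * (1 - ‖z‖ ^ 2)⁻¹ := by
        gcongr
        · exact hF.sum_le_tsum _ fun _ _ => by positivity
        · rw [← hgeo.tsum_eq]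
          refine le_trans (le_of_eq ?_)
            (hgeo.summable.sum_le_tsum (Finset.range N) fun _ _ => by positivity)
          exact Finset.sum_congr rfl fun n _ => by rw [← pow_mul, ← pow_mul, mul_comm]

end SqSummable

section Radial

variable {F G : PowerSeries ℂ} {ζ : ℂ}

lemma radial_mem_unitDisk (hζ : ‖ζ‖ = 1) {r : ℝ} (hr : r ∈ Ioo (0 : ℝ) 1) :
    (r : ℂ) * ζ ∈ unitDisk := by
  rw [mem_unitDisk, norm_mul, hζ, mul_one, Complex.norm_real, Real.norm_eq_abs, abs_of_pos hr.1]
  exact hr.2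

lemma eventually_radius : ∀ᶠ r : ℝ in 𝓝[<] 1, r ∈ Ioo (0 : ℝ) 1 :=
  Ioo_mem_nhdsLT one_pos

lemma tendsto_radial (ζ : ℂ) : Tendsto (fun r : ℝ => (r : ℂ) * ζ) (𝓝[<] 1) (𝓝 ζ) := by
  have h : Continuous fun r : ℝ => (r : ℂ) * ζ := by fun_prop
  simpa using (h.tendsto 1).mono_left nhdsWithin_le_nhds

lemma tendsto_eval_radial (P : Polynomial ℂ) (ζ : ℂ) :
    Tendsto (fun r : ℝ => P.eval ((r : ℂ) * ζ)) (𝓝[<] 1) (𝓝 (P.eval ζ)) :=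
  (P.continuous.tendsto ζ).comp (tendsto_radial ζ)

lemma tendsto_one_sub : Tendsto (fun r : ℝ => 1 - r) (𝓝[<] 1) (𝓝 0) := by
  have h : Continuous fun r : ℝ => 1 - r := by fun_prop
  simpa using (h.tendsto 1).mono_left nhdsWithin_le_nhds

/-- Functions in `H²` are `o((1 - r)^{-1/2})` along radii. -/
lemma SqSummable.tendsto_radial_sq (hF : SqSummable F) (hζ : ‖ζ‖ = 1) :
    Tendsto (fun r : ℝ => (1 - r) * ‖evalSeries F (r * ζ)‖ ^ 2) (𝓝[<] 1) (𝓝 0) := by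
  rw [Metric.tendsto_nhds]
  intro ε hε
  have htail := tendsto_sum_nat_add fun n => ‖coeff n F‖ ^ 2
  obtain ⟨N, hN⟩ := (htail.eventually (gt_mem_nhds (show (0 : ℝ) < ε / 4 by positivity))).exists
  set G : PowerSeries ℂ := PowerSeries.mk fun i => coeff (i + N) F with hG
  have hGs : SqSummable G := hF.shift N
  have hGsum : ∑' n, ‖coeff n G‖ ^ 2 < ε / 4 := by simpa [hG] using hN
  have hpoly : Tendsto (fun r : ℝ => (1 - r) * (2 * ‖(trunc N F).eval ((r : ℂ) * ζ)‖ ^ 2))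
      (𝓝[<] 1) (𝓝 0) := by
    simpa using tendsto_one_sub.mul (((tendsto_eval_radial (trunc N F) ζ).norm.pow 2).const_mul 2)
  filter_upwards [eventually_radius,
    hpoly.eventually (gt_mem_nhds (show (0 : ℝ) < ε / 2 by positivity))] with r hr hP
  have hz := radial_mem_unitDisk hζ hr
  have hnorm : ‖(r : ℂ) * ζ‖ = r := by
    rw [norm_mul, hζ, mul_one, Complex.norm_real, Real.norm_eq_abs, abs_of_pos hr.1]
  have hdec : evalSeries F (r * ζ) =
      ((r : ℂ) * ζ) ^ N * evalSeries G (r * ζ) + (trunc N F).eval ((r : ℂ) * ζ) := by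
    conv_lhs => rw [eq_X_pow_mul_shift_add_trunc N F]
    have hX : (X : PowerSeries ℂ) ^ N = ((Polynomial.X ^ N : Polynomial ℂ) : PowerSeries ℂ) := by
      simp
    rw [hX, ((convDisk_coe _).mul hGs.convDisk).evalSeries_add (convDisk_coe _) hz,
      (convDisk_coe _).evalSeries_mul hGs.convDisk hz, evalSeries_coe, evalSeries_coe]
    simp
  have h1 := hGs.norm_evalSeries_sq_le hz
  rw [hnorm] at h1
  have h2 : ‖evalSeries F (r * ζ)‖ ≤
      ‖evalSeries G (r * ζ)‖ + ‖(trunc N F).eval ((r : ℂ) * ζ)‖ := by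
    rw [hdec]
    refine (norm_add_le _ _).trans ?_
    gcongr
    rw [norm_mul, norm_pow, hnorm]
    exact mul_le_of_le_one_left (norm_nonneg _) (pow_le_one₀ hr.1.le hr.2.le)
  have h3 : (1 - r) * ‖evalSeries G (r * ζ)‖ ^ 2 ≤ ∑' n, ‖coeff n G‖ ^ 2 := by
    have hr1 : 0 < 1 - r := sub_pos.2 hr.2
    have hr2 : 0 < 1 - r ^ 2 := by nlinarith [hr.1]
    have hS : 0 ≤ ∑' n, ‖coeff n G‖ ^ 2 := tsum_nonneg fun _ => by positivity
    calc (1 - r) * ‖evalSeries G (r * ζ)‖ ^ 2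
        ≤ (1 - r ^ 2) * ((∑' n, ‖coeff n G‖ ^ 2) * (1 - r ^ 2)⁻¹) := by
          gcongr
          nlinarith [hr.1]
      _ = ∑' n, ‖coeff n G‖ ^ 2 := by field_simp
  have h4 : ‖evalSeries F (r * ζ)‖ ^ 2 ≤
      2 * ‖evalSeries G (r * ζ)‖ ^ 2 + 2 * ‖(trunc N F).eval ((r : ℂ) * ζ)‖ ^ 2 := by
    nlinarith [sq_nonneg (‖evalSeries G (r * ζ)‖ - ‖(trunc N F).eval ((r : ℂ) * ζ)‖),
      norm_nonneg (evalSeries F (r * ζ))]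
  have hr1 : 0 < 1 - r := sub_pos.2 hr.2
  rw [Real.dist_eq, sub_zero, abs_of_nonneg (by positivity)]
  have h5 := mul_le_mul_of_nonneg_left h4 hr1.le
  linarith

lemma SqSummable.tendsto_radial_mul (hF : SqSummable F) (hG : SqSummable G) (hζ : ‖ζ‖ = 1) :
    Tendsto (fun r : ℝ => ((r : ℂ) * ζ - ζ) * (evalSeries F (r * ζ) * evalSeries G (r * ζ)))
      (𝓝[<] 1) (𝓝 0) := by
  have h := (hF.tendsto_radial_sq hζ).add (hG.tendsto_radial_sq hζ)
  rw [add_zero] at h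
  refine squeeze_zero_norm' ?_ h
  filter_upwards [eventually_radius] with r hr
  have hr1 : 0 < 1 - r := sub_pos.2 hr.2
  have h1 : ‖(r : ℂ) * ζ - ζ‖ = 1 - r := by
    have : (r : ℂ) * ζ - ζ = ((r - 1 : ℝ) : ℂ) * ζ := by push_cast; ring
    rw [this, norm_mul, hζ, mul_one, Complex.norm_real, Real.norm_eq_abs, abs_of_nonpos (by linarith)]
    ring
  rw [norm_mul, norm_mul, h1, ← mul_add]
  gcongr
  nlinarith [sq_nonneg (‖evalSeries F (r * ζ)‖ - ‖evalSeries G (r * ζ)‖),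
    sq_nonneg ‖evalSeries F (r * ζ)‖, sq_nonneg ‖evalSeries G (r * ζ)‖]

lemma sqSummable_one : SqSummable 1 := by
  simpa using sqSummable_coe 1

lemma evalSeries_one (z : ℂ) : evalSeries 1 z = 1 := by
  simpa using evalSeries_coe 1 z

lemma SqSummable.tendsto_radial (hF : SqSummable F) (hζ : ‖ζ‖ = 1) :
    Tendsto (fun r : ℝ => ((r : ℂ) * ζ - ζ) * evalSeries F (r * ζ)) (𝓝[<] 1) (𝓝 0) := by
  simpa [evalSeries_one] using hF.tendsto_radial_mul sqSummable_one hζ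

/-- A function in `H²` without a finite radial limit at `ζ`. -/
lemma exists_sqSummable_no_radial_limit (hζ : ‖ζ‖ = 1) :
    ∃ F, SqSummable F ∧ ∀ L, ¬ Tendsto (fun r : ℝ => evalSeries F (r * ζ)) (𝓝[<] 1) (𝓝 L) := by
  have hζ0 : ζ ≠ 0 := by
    rintro rfl
    simp at hζ
  set F : PowerSeries ℂ := PowerSeries.mk fun n => ζ⁻¹ ^ n / ((n + 1 : ℝ) : ℂ) with hFdef
  have hnorm : ∀ n, ‖coeff n F‖ = 1 / ((n : ℝ) + 1) := by
    intro n
    rw [hFdef, coeff_mk, norm_div, norm_pow, norm_inv, hζ, Complex.norm_real, Real.norm_eq_abs,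
      abs_of_pos (by positivity)]
    simp
  have hF : SqSummable F := by
    have h := (summable_nat_add_iff 1).2 (Real.summable_one_div_nat_pow.2 one_lt_two)
    refine h.congr fun n => ?_
    rw [hnorm]
    push_cast
    rw [div_pow, one_pow]
  refine ⟨F, hF, fun L hL => ?_⟩
  have hre : Tendsto (fun r : ℝ => (evalSeries F (r * ζ)).re) (𝓝[<] 1) (𝓝 L.re) :=
    (Complex.continuous_re.tendsto L).comp hL
  have hbound : ∀ N, ∑ n ∈ Finset.range N, 1 / ((n : ℝ) + 1) ≤ L.re := by
    intro N
    have hlim : Tendsto (fun r : ℝ => ∑ n ∈ Finset.range N, r ^ n / ((n : ℝ) + 1)) (𝓝[<] 1)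
        (𝓝 (∑ n ∈ Finset.range N, 1 / ((n : ℝ) + 1))) := by
      have h : Continuous fun r : ℝ => ∑ n ∈ Finset.range N, r ^ n / ((n : ℝ) + 1) := by fun_prop
      simpa using (h.tendsto 1).mono_left nhdsWithin_le_nhds
    refine le_of_tendsto_of_tendsto hlim hre ?_
    filter_upwards [eventually_radius] with r hr
    have hs := hF.convDisk.hasSum (radial_mem_unitDisk hζ hr)
    have hterm : ∀ n, coeff n F * ((r : ℂ) * ζ) ^ n = ((r ^ n / ((n : ℝ) + 1) : ℝ) : ℂ) := by
      intro n
      rw [hFdef, coeff_mk, mul_pow, inv_pow]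
      push_cast
      field_simp
    have hs' : HasSum (fun n : ℕ => r ^ n / ((n : ℝ) + 1)) (evalSeries F (r * ζ)).re := by
      have := Complex.hasSum_re hs
      simpa only [hterm, Complex.ofReal_re] using this
    exact sum_le_hasSum _ (fun n _ => div_nonneg (pow_nonneg hr.1.le _) (by positivity)) hs'
  obtain ⟨N, hN⟩ := (Real.tendsto_sum_range_one_div_nat_succ_atTop.eventually
    (eventually_gt_atTop L.re)).exists
  exact absurd (hbound N) (not_le.2 hN)

end Radial

section Bounded

open MeasureTheory

lemma hasSum_sq_of_orthonormal {ι E : Type*} [NormedAddCommGroup E] [InnerProductSpace ℂ E]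
    {e : ι → E} (he : Orthonormal ℂ e) {a : ι → ℂ} {v : E} (h : HasSum (fun i => a i • e i) v) :
    HasSum (fun i => ‖a i‖ ^ 2) (‖v‖ ^ 2) := by
  classical
  have hcoef : ∀ i, inner ℂ (e i) v = a i := by
    intro i
    have h1 := (innerSL ℂ (e i)).hasSum h
    refine h1.unique ?_
    have h2 := hasSum_single (f := fun j => innerSL ℂ (e i) (a j • e j)) i fun j hj => by
      simp [he.2 hj.symm]
    simpa [Function.comp_def, inner_smul_right, he.1 i] using h2
  have h1 := (innerSL ℂ v).hasSum h
  have h2 : HasSum (fun i => ((‖a i‖ ^ 2 : ℝ) : ℂ)) (((‖v‖ ^ 2 : ℝ)) : ℂ) := by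
    have hfun : (fun i => ((‖a i‖ ^ 2 : ℝ) : ℂ)) = fun i => innerSL ℂ v (a i • e i) := by
      funext i
      rw [innerSL_apply_apply, inner_smul_right, ← inner_conj_symm, hcoef i,
        Complex.mul_conj, Complex.normSq_eq_norm_sq]
    have hv : (((‖v‖ ^ 2 : ℝ)) : ℂ) = innerSL ℂ v v := by
      rw [innerSL_apply_apply, inner_self_eq_norm_sq_to_K]
      push_cast
      rfl
    rw [hfun, hv]
    exact h1
  exact_mod_cast h2

variable {F G : PowerSeries ℂ}

/-- Parseval's identity on the circle of radius `r`. -/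
lemma ConvDisk.exists_parseval (hF : ConvDisk F) {r : ℝ} (hr : r ∈ Ioo (0 : ℝ) 1) :
    ∃ g : C(UnitAddCircle, ℂ), (∀ t, g t = evalSeries F (r * t.toCircle)) ∧
      HasSum (fun n => ‖coeff n F * (r : ℂ) ^ n‖ ^ 2)
        (‖ContinuousMap.toLp (E := ℂ) 2 AddCircle.haarAddCircle ℂ g‖ ^ 2) := by
  have hmem : (r : ℂ) ∈ unitDisk := by
    simpa using radial_mem_unitDisk (ζ := 1) (by simp) hr
  have hs : Summable fun n : ℕ => (coeff n F * (r : ℂ) ^ n) • fourier (T := 1) (n : ℤ) := by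
    refine Summable.of_norm ((hF _ hmem).congr fun n => ?_)
    rw [norm_smul, fourier_norm, mul_one]
  refine ⟨∑' n : ℕ, (coeff n F * (r : ℂ) ^ n) • fourier (T := 1) (n : ℤ), fun t => ?_, ?_⟩
  · have h := (ContinuousMap.evalCLM ℂ t).hasSum hs.hasSum
    rw [ContinuousMap.evalCLM_apply] at h
    rw [evalSeries, ← h.tsum_eq]
    refine tsum_congr fun n => ?_
    simp [fourier_apply, AddCircle.toCircle_nsmul, mul_pow, mul_assoc]
  · have h := (ContinuousMap.toLp (E := ℂ) 2 (AddCircle.haarAddCircle (T := 1)) ℂ).hasSum hs.hasSum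
    refine hasSum_sq_of_orthonormal
      ((orthonormal_fourier (T := 1)).comp (fun n : ℕ => (n : ℤ)) Nat.cast_injective) ?_
    simpa [Function.comp_def] using h

/-- Multiplication by a bounded analytic function preserves `H²`. -/
lemma SqSummable.bounded_mul (hG : ConvDisk G) {c : ℝ}
    (hc : ∀ z ∈ unitDisk, ‖evalSeries G z‖ ≤ c) (hF : SqSummable F) : SqSummable (G * F) := by
  have hc0 : 0 ≤ c := (norm_nonneg _).trans (hc 0 (by simp [mem_unitDisk]))
  set S := ∑' n, ‖coeff n F‖ ^ 2 with hS
  refine summable_of_sum_range_le (c := c ^ 2 * S) (fun _ => by positivity) fun N => ?_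
  have hlim : Tendsto (fun r : ℝ => ∑ n ∈ Finset.range N, ‖coeff n (G * F) * (r : ℂ) ^ n‖ ^ 2)
      (𝓝[<] 1) (𝓝 (∑ n ∈ Finset.range N, ‖coeff n (G * F)‖ ^ 2)) := by
    have h : Continuous fun r : ℝ =>
      ∑ n ∈ Finset.range N, ‖coeff n (G * F) * (r : ℂ) ^ n‖ ^ 2 := by fun_prop
    simpa using (h.tendsto 1).mono_left nhdsWithin_le_nhds
  refine le_of_tendsto hlim ?_
  filter_upwards [eventually_radius] with r hr
  obtain ⟨g, hg, hgs⟩ := hF.convDisk.exists_parseval hr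
  obtain ⟨u, hu, hus⟩ := (hG.mul hF.convDisk).exists_parseval hr
  have hle : ‖ContinuousMap.toLp (E := ℂ) 2 AddCircle.haarAddCircle ℂ u‖ ≤
      c * ‖ContinuousMap.toLp (E := ℂ) 2 AddCircle.haarAddCircle ℂ g‖ := by
    refine Lp.norm_le_mul_norm_of_ae_le_mul ?_
    filter_upwards [ContinuousMap.coeFn_toLp (E := ℂ) (p := 2) (𝕜 := ℂ) AddCircle.haarAddCircle u,
      ContinuousMap.coeFn_toLp (E := ℂ) (p := 2) (𝕜 := ℂ) AddCircle.haarAddCircle g] with t h1 h2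
    have hz := radial_mem_unitDisk (Circle.norm_coe t.toCircle) hr
    rw [h1, h2, hu, hg, hG.evalSeries_mul hF.convDisk hz, norm_mul]
    gcongr
    exact hc _ hz
  calc ∑ n ∈ Finset.range N, ‖coeff n (G * F) * (r : ℂ) ^ n‖ ^ 2
      ≤ ‖ContinuousMap.toLp (E := ℂ) 2 AddCircle.haarAddCircle ℂ u‖ ^ 2 :=
        sum_le_hasSum _ (fun _ _ => by positivity) hus
    _ ≤ (c * ‖ContinuousMap.toLp (E := ℂ) 2 AddCircle.haarAddCircle ℂ g‖) ^ 2 := by gcongr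
    _ = c ^ 2 * ‖ContinuousMap.toLp (E := ℂ) 2 AddCircle.haarAddCircle ℂ g‖ ^ 2 := by ring
    _ ≤ c ^ 2 * S := by
        gcongr
        refine hasSum_le (fun n => ?_) hgs hF.hasSum
        rw [norm_mul, norm_pow, Complex.norm_real, Real.norm_eq_abs, abs_of_pos hr.1]
        refine pow_le_pow_left₀ (by have := hr.1; positivity) ?_ 2
        exact mul_le_of_le_one_right (norm_nonneg (coeff n F)) (pow_le_one₀ hr.1.le hr.2.le)

/-- A multiplier of `H²` is bounded on the disk. -/
lemma exists_bound_of_multiplier (hG : ∀ F, SqSummable F → SqSummable (G * F)) :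
    ∃ c : ℝ, ∀ z ∈ unitDisk, ‖evalSeries G z‖ ≤ c := by
  have hmem : ∀ f : lp (fun _ : ℕ => ℂ) 2, SqSummable (PowerSeries.mk fun n => f n) := by
    intro f
    simpa [SqSummable] using (memℓp_gen_iff (p := 2) (by norm_num)).1 (lp.memℓp f)
  have hmem' : ∀ F, SqSummable F → Memℓp (fun n => coeff n F : ℕ → ℂ) 2 := by
    intro F hF
    refine (memℓp_gen_iff (E := fun _ : ℕ => ℂ) (p := 2) (by norm_num)).2 ?_
    simpa [SqSummable] using hF
  let T : lp (fun _ : ℕ => ℂ) 2 →ₗ[ℂ] lp (fun _ : ℕ => ℂ) 2 :=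
    { toFun := fun f => ⟨fun n => coeff n (G * PowerSeries.mk fun n => f n),
        hmem' _ (hG _ (hmem f))⟩
      map_add' := by
        intro f g
        ext n
        simp only [coeff_mul, coeff_mk, lp.coeFn_add, Pi.add_apply, mul_add,
          Finset.sum_add_distrib]
      map_smul' := by
        intro a f
        ext n
        simp only [coeff_mul, coeff_mk, lp.coeFn_smul, Pi.smul_apply, smul_eq_mul,
          RingHom.id_apply, Finset.mul_sum]
        exact Finset.sum_congr rfl fun _ _ => by ring }
  have hT : ∀ f n, T f n = coeff n (G * PowerSeries.mk fun n => f n) := fun _ _ => rfl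
  have hcoord : ∀ n, Continuous fun f : lp (fun _ : ℕ => ℂ) 2 => f n := by
    intro n
    exact (lp.evalCLM ℂ (fun _ : ℕ => ℂ) 2 n).continuous
  have hcont : Continuous T := by
    refine T.continuous_of_seq_closed_graph fun u x y hu hy => ?_
    ext n
    have h1 := ((hcoord n).tendsto y).comp hy
    refine tendsto_nhds_unique h1 ?_
    have h2 : Continuous fun f : lp (fun _ : ℕ => ℂ) 2 => T f n := by
      simp only [hT, coeff_mul, coeff_mk]
      exact continuous_finsetSum _ fun p _ => continuous_const.mul (hcoord p.2)
    exact (h2.tendsto x).comp hu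
  obtain ⟨c, hc0, hc⟩ := (⟨T, hcont⟩ : lp (fun _ : ℕ => ℂ) 2 →L[ℂ] lp (fun _ : ℕ => ℂ) 2).bound
  have hnorm : ∀ f : lp (fun _ : ℕ => ℂ) 2, ‖f‖ ^ 2 = ∑' n, ‖f n‖ ^ 2 := by
    intro f
    simpa using lp.norm_rpow_eq_tsum (p := 2) (by norm_num) f
  have hGs : SqSummable G := by simpa using hG 1 sqSummable_one
  refine ⟨c, fun w hw => ?_⟩
  have hw' := mem_unitDisk.1 hw
  have hpos : 0 < 1 - ‖w‖ ^ 2 := by nlinarith [norm_nonneg w]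
  set S := (1 - ‖w‖ ^ 2)⁻¹ with hS
  have hS0 : 0 < S := inv_pos.2 hpos
  have hgeo : HasSum (fun n : ℕ => (‖w‖ ^ 2) ^ n) S :=
    hasSum_geometric_of_lt_one (by positivity) (by linarith)
  set K : PowerSeries ℂ := PowerSeries.mk fun n => (starRingEnd ℂ) w ^ n with hK
  have hKcoef : ∀ n, ‖coeff n K‖ ^ 2 = (‖w‖ ^ 2) ^ n := by
    intro n
    rw [hK, coeff_mk, norm_pow, RCLike.norm_conj, ← pow_mul, ← pow_mul, mul_comm]
  have hKs : SqSummable K := hgeo.summable.congr fun n => (hKcoef n).symm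
  have hKw : evalSeries K w = S := by
    refine HasSum.tsum_eq ?_
    have h := (Complex.hasSum_ofReal (f := fun n : ℕ => (‖w‖ ^ 2) ^ n)).2 hgeo
    refine h.congr_fun fun n => ?_
    rw [hK, coeff_mk, ← mul_pow, mul_comm, Complex.mul_conj, Complex.normSq_eq_norm_sq]
    push_cast
    rfl
  let f : lp (fun _ : ℕ => ℂ) 2 := ⟨fun n => coeff n K, hmem' K hKs⟩
  have hf : (PowerSeries.mk fun n => f n) = K := by
    ext n
    rw [coeff_mk]
  have hfn : ‖f‖ ^ 2 = S := by
    rw [hnorm, ← hgeo.tsum_eq]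
    exact tsum_congr hKcoef
  have hTf : ∑' n, ‖coeff n (G * K)‖ ^ 2 = ‖T f‖ ^ 2 := by
    rw [hnorm]
    simp only [hT, hf]
  have h1 := (hG K hKs).norm_evalSeries_sq_le hw
  rw [hGs.convDisk.evalSeries_mul hKs.convDisk hw, hKw, hTf, norm_mul, Complex.norm_real,
    Real.norm_eq_abs, abs_of_pos hS0] at h1
  have h2 : ‖T f‖ ^ 2 ≤ c ^ 2 * S := by
    rw [← hfn, ← mul_pow]
    gcongr
    exact hc f
  have h3 : (‖evalSeries G w‖ * S) ^ 2 ≤ (c * S) ^ 2 := by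
    calc _ ≤ ‖T f‖ ^ 2 * S := h1
      _ ≤ c ^ 2 * S * S := by gcongr
      _ = _ := by ring
  exact le_of_mul_le_mul_right ((sq_le_sq₀ (by positivity) (by positivity)).1 h3) hS0

end Bounded

section Algebra

variable {F G : PowerSeries ℂ}

/-- The backward shift on power series. -/
def backShift : Module.End ℂ (PowerSeries ℂ) where
  toFun F := PowerSeries.mk fun n => coeff (n + 1) F
  map_add' F G := by ext n; simp
  map_smul' a F := by ext n; simp

lemma coeff_backShift (F : PowerSeries ℂ) (n : ℕ) : coeff n (backShift F) = coeff (n + 1) F := by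
  simp [backShift]

lemma coeff_backShift_pow (F : PowerSeries ℂ) (k n : ℕ) :
    coeff n ((backShift ^ k) F) = coeff (n + k) F := by
  induction k generalizing n with
  | zero => simp
  | succ k ih => rw [pow_succ', Module.End.mul_apply, coeff_backShift, ih]; congr 2; ring

lemma X_mul_backShift (F : PowerSeries ℂ) : X * backShift F = F - C (constantCoeff F) :=
  (sub_const_eq_X_mul_shift F).symm

lemma SqSummable.backShift (hF : SqSummable F) : SqSummable (backShift F) := hF.shift 1

/-- The monic polynomial with prescribed roots. -/
abbrev rootsPoly (s : Multiset ℂ) : Polynomial ℂ :=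
  (s.map fun ζ => Polynomial.X - Polynomial.C ζ).prod

lemma rootsPoly_cons (ζ : ℂ) (s : Multiset ℂ) :
    rootsPoly (ζ ::ₘ s) = (Polynomial.X - Polynomial.C ζ) * rootsPoly s := by
  simp [rootsPoly]

lemma X_mul_backShift_sub (D : PowerSeries ℂ) (c : ℂ) :
    X * (backShift D - c • D) = (1 - C c * X) * D - C (constantCoeff D) := by
  rw [mul_sub, X_mul_backShift, smul_eq_C_mul]
  ring

/-- The range of the coanalytic Toeplitz operator, at the level of Taylor series. -/
lemma exists_aeval_backShift_iff (s : Multiset ℂ) (hs : ∀ ζ ∈ s, ‖ζ‖ = 1) (G : PowerSeries ℂ) :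
    (∃ F, SqSummable F ∧
      G = Polynomial.aeval backShift ((rootsPoly s).map (starRingEnd ℂ)) F) ↔
      ∃ (H : PowerSeries ℂ) (p : Polynomial ℂ), SqSummable H ∧ G = (rootsPoly s) * H + p := by
  induction s using Multiset.induction_on generalizing G with
  | empty =>
    simp only [rootsPoly, Multiset.map_zero, Multiset.prod_zero, Polynomial.map_one, map_one,
      Module.End.one_apply, Polynomial.coe_one, one_mul]
    constructor
    · rintro ⟨F, hF, rfl⟩
      exact ⟨G, 0, hF, by simp⟩
    · rintro ⟨H, p, hH, rfl⟩
      exact ⟨_, hH.add (sqSummable_coe p), rfl⟩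
  | cons ζ s ih =>
    have ih := ih fun ζ hζ => hs ζ (Multiset.mem_cons_of_mem hζ)
    have hζ : (starRingEnd ℂ) ζ * ζ = 1 := by
      rw [mul_comm, Complex.mul_conj, Complex.normSq_eq_norm_sq, hs ζ (Multiset.mem_cons_self ζ s)]
      simp
    set b := (starRingEnd ℂ) ζ with hb
    have hCζ : (C b : PowerSeries ℂ) * C ζ = 1 := by rw [← map_mul, hζ, map_one]
    have haeval : ∀ F, Polynomial.aeval backShift ((rootsPoly (ζ ::ₘ s)).map (starRingEnd ℂ)) F =
        backShift (Polynomial.aeval backShift ((rootsPoly s).map (starRingEnd ℂ)) F) -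
          b • Polynomial.aeval backShift ((rootsPoly s).map (starRingEnd ℂ)) F := by
      intro F
      rw [rootsPoly_cons, Polynomial.map_mul, map_mul, Module.End.mul_apply]
      simp [← hb]
    simp only [haeval]
    simp only [rootsPoly_cons, Polynomial.coe_mul, Polynomial.coe_sub, Polynomial.coe_X,
      Polynomial.coe_C]
    constructor
    · rintro ⟨F, hF, rfl⟩
      obtain ⟨H, p, hH, hD⟩ := (ih _).1 ⟨F, hF, rfl⟩
      set D := Polynomial.aeval backShift ((rootsPoly s).map (starRingEnd ℂ)) F
      set R : Polynomial ℂ := (1 - Polynomial.C b * Polynomial.X) *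
        (rootsPoly s * Polynomial.C (constantCoeff H) + p) - Polynomial.C (constantCoeff D) with hR
      have hH' := X_mul_backShift H
      have hX : X * (backShift D - b • D) =
          X * ((X - C ζ) * (rootsPoly s : PowerSeries ℂ) * (C (-b) * backShift H)) + (R : PowerSeries ℂ) := by
        rw [X_mul_backShift_sub, hR]
        simp only [Polynomial.coe_mul, Polynomial.coe_sub, Polynomial.coe_add, Polynomial.coe_X,
          Polynomial.coe_C, Polynomial.coe_one, map_neg]
        linear_combination (1 - C b * X) * hD +
          (C b * (X - C ζ) * (rootsPoly s : PowerSeries ℂ)) * hH' -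
          ((rootsPoly s : PowerSeries ℂ) * (H - C (constantCoeff H))) * hCζ
      have hR0 : R.coeff 0 = 0 := by
        have h := congrArg constantCoeff hX
        simp only [map_mul, map_add, constantCoeff_X, zero_mul, zero_add] at h
        rw [← Polynomial.coeff_coe, coeff_zero_eq_constantCoeff_apply, ← h]
      have hRX : (R : PowerSeries ℂ) = X * (R.divX : PowerSeries ℂ) := by
        conv_lhs => rw [← Polynomial.divX_mul_X_add R, hR0]
        simp [mul_comm]
      refine ⟨C (-b) * backShift H, R.divX, hH.backShift.C_mul _, ?_⟩
      rw [hRX, ← mul_add] at hX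
      exact mul_left_cancel₀ X_ne_zero hX
    · rintro ⟨H, p, hH, rfl⟩
      have hroot : (Polynomial.X * p + Polynomial.C (-ζ * p.eval ζ)).IsRoot ζ := by
        simp [Polynomial.IsRoot]
      obtain ⟨q, hq⟩ := Polynomial.dvd_iff_isRoot.2 hroot
      have hq' := congrArg (fun U : Polynomial ℂ => (U : PowerSeries ℂ)) hq
      simp only [Polynomial.coe_mul, Polynomial.coe_sub, Polynomial.coe_add, Polynomial.coe_X,
        Polynomial.coe_C] at hq'
      obtain ⟨F, hF, hD⟩ := (ih ((rootsPoly s : PowerSeries ℂ) * (C (-ζ) * (X * H)) +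
        ((Polynomial.C (-ζ) * q : Polynomial ℂ) : PowerSeries ℂ))).2
        ⟨_, _, hH.X_mul.C_mul _, rfl⟩
      refine ⟨F, hF, ?_⟩
      rw [← hD]
      set D := (rootsPoly s : PowerSeries ℂ) * (C (-ζ) * (X * H)) +
        ((Polynomial.C (-ζ) * q : Polynomial ℂ) : PowerSeries ℂ) with hDdef
      have h0 : constantCoeff D = -ζ * p.eval ζ := by
        have h := congrArg constantCoeff hq'
        simp only [map_mul, map_add, map_sub, constantCoeff_X, constantCoeff_C, zero_mul, zero_add,
          zero_sub] at h
        rw [h, hDdef]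
        simp
      refine mul_left_cancel₀ (X_ne_zero (R := ℂ)) ?_
      rw [X_mul_backShift_sub, h0, hDdef]
      simp only [Polynomial.coe_mul, Polynomial.coe_C] at hq' ⊢
      simp only [map_neg]
      linear_combination hq' + (-X * ((rootsPoly s : PowerSeries ℂ) * (X * H) + (q : PowerSeries ℂ))) * hCζ

/-- Division of polynomials with unimodular roots inside `H²`. -/
lemma exists_poly_of_rootsPoly_mul (s : Multiset ℂ) (hs : ∀ ζ ∈ s, ‖ζ‖ = 1) (hG : SqSummable G)
    (P : Polynomial ℂ) (h : (rootsPoly s) * G = (P : PowerSeries ℂ)) :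
    ∃ Q : Polynomial ℂ, G = Q := by
  induction s using Multiset.induction_on generalizing P with
  | empty => exact ⟨P, by simpa [rootsPoly] using h⟩
  | cons ζ s ih =>
    have hζ := hs ζ (Multiset.mem_cons_self ζ s)
    rw [rootsPoly_cons, Polynomial.coe_mul, mul_assoc] at h
    have hsq : SqSummable ((rootsPoly s) * G) := hG.coe_mul _
    have hroot : P.eval ζ = 0 := by
      refine tendsto_nhds_unique (tendsto_eval_radial P ζ) ((hsq.tendsto_radial hζ).congr' ?_)
      filter_upwards [eventually_radius] with r hr
      rw [← evalSeries_coe, ← h, (convDisk_coe _).evalSeries_mul hsq.convDisk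
        (radial_mem_unitDisk hζ hr), evalSeries_coe]
      simp
    obtain ⟨Q, rfl⟩ := Polynomial.dvd_iff_isRoot.2 hroot
    rw [Polynomial.coe_mul] at h
    refine ih (fun ξ hξ => hs ξ (Multiset.mem_cons_of_mem hξ)) Q (mul_left_cancel₀ ?_ h)
    exact mt Polynomial.coe_eq_zero_iff.1 (Polynomial.X_sub_C_ne_zero ζ)

/-- A function multiplying `H²` into `a H² + ℂ[z]` is divisible by `a`, with a quotient which
multiplies `H²` into itself. -/
lemma exists_multiplier_of_mul_mem (s : Multiset ℂ) (hs : ∀ ζ ∈ s, ‖ζ‖ = 1) (Φ : PowerSeries ℂ)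
    (h : ∀ F, SqSummable F → ∃ (H : PowerSeries ℂ) (p : Polynomial ℂ), SqSummable H ∧
      Φ * F = (rootsPoly s) * H + p) :
    ∃ Ψ : PowerSeries ℂ, Φ = (rootsPoly s) * Ψ ∧ ∀ F, SqSummable F → SqSummable (Ψ * F) := by
  induction s using Multiset.induction_on generalizing Φ with
  | empty =>
    refine ⟨Φ, by simp [rootsPoly], fun F hF => ?_⟩
    obtain ⟨H, p, hH, hp⟩ := h F hF
    rw [hp]
    exact (hH.coe_mul _).add (sqSummable_coe p)
  | cons ζ s ih =>
    have hζ := hs ζ (Multiset.mem_cons_self ζ s)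
    simp only [rootsPoly_cons, Polynomial.coe_mul, mul_assoc] at h ⊢
    have hne : ((Polynomial.X - Polynomial.C ζ : Polynomial ℂ) : PowerSeries ℂ) ≠ 0 :=
      mt Polynomial.coe_eq_zero_iff.1 (Polynomial.X_sub_C_ne_zero ζ)
    have hlim : ∀ (H : PowerSeries ℂ) (p : Polynomial ℂ), SqSummable H →
        Tendsto (fun r : ℝ => evalSeries
          ((Polynomial.X - Polynomial.C ζ : Polynomial ℂ) * H + (p : PowerSeries ℂ)) (r * ζ))
          (𝓝[<] 1) (𝓝 (p.eval ζ)) := by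
      intro H p hH
      have h1 := (hH.tendsto_radial hζ).add (tendsto_eval_radial p ζ)
      rw [zero_add] at h1
      refine h1.congr' ?_
      filter_upwards [eventually_radius] with r hr
      have hz := radial_mem_unitDisk hζ hr
      rw [((convDisk_coe _).mul hH.convDisk).evalSeries_add (convDisk_coe _) hz,
        (convDisk_coe _).evalSeries_mul hH.convDisk hz, evalSeries_coe, evalSeries_coe]
      simp
    obtain ⟨H₁, p₁, hH₁, h₁⟩ := h 1 sqSummable_one
    rw [mul_one] at h₁
    have hΦ : SqSummable Φ := by
      rw [h₁]
      exact ((hH₁.coe_mul _).coe_mul _).add (sqSummable_coe _)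
    have hlimΦ := hlim _ p₁ (hH₁.coe_mul (rootsPoly s))
    rw [← h₁] at hlimΦ
    have hp₁ : p₁.eval ζ = 0 := by
      by_contra hne0
      obtain ⟨F, hF, hFlim⟩ := exists_sqSummable_no_radial_limit hζ
      obtain ⟨H, p, hH, hp⟩ := h F hF
      have h2 := hlim _ p (hH.coe_mul (rootsPoly s))
      rw [← hp] at h2
      refine hFlim _ ((h2.div hlimΦ hne0).congr' ?_)
      filter_upwards [eventually_radius, hlimΦ.eventually_ne hne0] with r hr hr0
      rw [Pi.div_apply, hΦ.convDisk.evalSeries_mul hF.convDisk (radial_mem_unitDisk hζ hr),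
        mul_div_cancel_left₀ _ hr0]
    obtain ⟨q₁, rfl⟩ := Polynomial.dvd_iff_isRoot.2 hp₁
    rw [Polynomial.coe_mul, ← mul_add] at h₁
    set Φ₁ : PowerSeries ℂ := (rootsPoly s) * H₁ + q₁ with hΦ₁
    have hΦ₁s : SqSummable Φ₁ := (hH₁.coe_mul _).add (sqSummable_coe _)
    obtain ⟨Ψ, hΨ, hΨm⟩ := ih (fun ξ hξ => hs ξ (Multiset.mem_cons_of_mem hξ)) Φ₁ fun F hF => by
      obtain ⟨H, p, hH, hp⟩ := h F hF
      have h2 := hlim _ p (hH.coe_mul (rootsPoly s))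
      rw [← hp] at h2
      have hp0 : p.eval ζ = 0 := by
        refine tendsto_nhds_unique h2 ((hΦ₁s.tendsto_radial_mul hF hζ).congr' ?_)
        filter_upwards [eventually_radius] with r hr
        have hz := radial_mem_unitDisk hζ hr
        rw [hΦ.convDisk.evalSeries_mul hF.convDisk hz, h₁,
          (convDisk_coe _).evalSeries_mul hΦ₁s.convDisk hz, evalSeries_coe]
        simp [mul_assoc]
      obtain ⟨q, rfl⟩ := Polynomial.dvd_iff_isRoot.2 hp0
      refine ⟨H, q, hH, mul_left_cancel₀ hne ?_⟩
      rw [← mul_assoc, ← h₁, hp, Polynomial.coe_mul, ← mul_add]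
    exact ⟨Ψ, by rw [h₁, hΨ], hΨm⟩

end Algebra

section Range

lemma memH2_iff {f : ℂ → ℂ} :
    MemH2 f ↔ ∃ F, SqSummable F ∧ EqOn f (evalSeries F) unitDisk := by
  constructor
  · rintro ⟨hf, hs⟩
    exact ⟨taylor f, by simpa [SqSummable, taylor] using hs, eqOn_evalSeries_taylor hf⟩
  · rintro ⟨F, hF, hf⟩
    refine ⟨hF.convDisk.differentiableOn.congr hf, ?_⟩
    simpa only [hF.convDisk.coef_eq hf, SqSummable] using hF

lemma Tbar_eq_evalSeries (P : Polynomial ℂ) {f : ℂ → ℂ} {F : PowerSeries ℂ} (hF : ConvDisk F)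
    (hf : EqOn f (evalSeries F) unitDisk) :
    Tbar (fun z => P.eval z) f =
      evalSeries (Polynomial.aeval backShift (P.map (starRingEnd ℂ)) F) := by
  funext z
  refine tsum_congr fun n => ?_
  congr 1
  rw [Polynomial.aeval_eq_sum_range, LinearMap.sum_apply, map_sum,
    tsum_eq_sum (s := Finset.range ((P.map (starRingEnd ℂ)).natDegree + 1))]
  · refine Finset.sum_congr rfl fun k _ => ?_
    rw [hF.coef_eq hf, (convDisk_coe P).coef_eq (fun z _ => (evalSeries_coe P z).symm),
      Polynomial.coeff_coe, LinearMap.smul_apply, PowerSeries.coeff_smul, coeff_backShift_pow,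
      Polynomial.coeff_map, smul_eq_mul]
  · intro k hk
    have h : (P.map (starRingEnd ℂ)).coeff k = 0 :=
      Polynomial.coeff_eq_zero_of_natDegree_lt (by rw [Finset.mem_range] at hk; omega)
    rw [(convDisk_coe P).coef_eq (fun z _ => (evalSeries_coe P z).symm), Polynomial.coeff_coe,
      ← Polynomial.coeff_map, h, zero_mul]

/-- The decomposition `M(ā) = a H² + ℂ[z]`. -/
lemma memMbar_rootsPoly_iff (s : Multiset ℂ) (hs : ∀ ζ ∈ s, ‖ζ‖ = 1) {g : ℂ → ℂ} :
    MemMbar (fun z => (rootsPoly s).eval z) g ↔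
      ∃ (H : PowerSeries ℂ) (p : Polynomial ℂ), SqSummable H ∧
        EqOn g (evalSeries ((rootsPoly s) * H + p)) unitDisk := by
  constructor
  · rintro ⟨f, hf, hg⟩
    obtain ⟨F, hF, hfF⟩ := memH2_iff.1 hf
    obtain ⟨H, p, hH, hp⟩ := (exists_aeval_backShift_iff s hs _).1 ⟨F, hF, rfl⟩
    rw [Tbar_eq_evalSeries _ hF.convDisk hfF, hp] at hg
    exact ⟨H, p, hH, hg⟩
  · rintro ⟨H, p, hH, hg⟩
    obtain ⟨F, hF, hp⟩ := (exists_aeval_backShift_iff s hs _).2 ⟨H, p, hH, rfl⟩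
    refine ⟨evalSeries F, memH2_iff.2 ⟨F, hF, fun _ _ => rfl⟩, ?_⟩
    rwa [Tbar_eq_evalSeries _ hF.convDisk (fun _ _ => rfl), ← hp]

lemma MemHinf.sqSummable_taylor_mul {f : ℂ → ℂ} (hf : MemHinf f) {F : PowerSeries ℂ}
    (hF : SqSummable F) : SqSummable (taylor f * F) := by
  obtain ⟨hd, c, hc⟩ := hf
  refine SqSummable.bounded_mul (c := c) (convDisk_taylor hd) (fun z hz => ?_) hF
  rw [← eqOn_evalSeries_taylor hd hz]
  exact hc z hz

lemma mult_rootsPoly_iff (s₁ s₂ : Multiset ℂ) (hs₁ : ∀ ζ ∈ s₁, ‖ζ‖ = 1) (hs₂ : ∀ ζ ∈ s₂, ‖ζ‖ = 1)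
    (k : ℂ → ℂ) (hk : MemHinf k)
    (hdiv : ∀ z ∈ unitDisk, (rootsPoly s₂).eval z = (rootsPoly s₁).eval z * k z) (φ : ℂ → ℂ) :
    Mult (fun z => (rootsPoly s₁).eval z) (fun z => (rootsPoly s₂).eval z) φ ↔
      DifferentiableOn ℂ φ unitDisk ∧
        ∃ ψ, MemMbar (fun z => (rootsPoly s₁).eval z) ψ ∧ MemHinf ψ ∧
          ∀ z ∈ unitDisk, φ z = k z * ψ z := by
  have hkconv := convDisk_taylor hk.1
  have hkev := eqOn_evalSeries_taylor hk.1
  set κ := taylor k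
  have hdivS : (rootsPoly s₂ : PowerSeries ℂ) = (rootsPoly s₁ : PowerSeries ℂ) * κ := by
    refine (convDisk_coe _).ext ((convDisk_coe _).mul hkconv) fun z hz => ?_
    rw [(convDisk_coe _).evalSeries_mul hkconv hz, evalSeries_coe, evalSeries_coe, hdiv z hz,
      hkev hz]
  have hne : (rootsPoly s₁ : PowerSeries ℂ) ≠ 0 :=
    mt Polynomial.coe_eq_zero_iff.1 (Polynomial.monic_multisetProd_X_sub_C s₁).ne_zero
  unfold Mult
  refine and_congr_right fun hφ => ?_
  have hφconv := convDisk_taylor hφ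
  have hφev := eqOn_evalSeries_taylor hφ
  set Φ := taylor φ
  constructor
  · intro h
    have hmul : ∀ (H : PowerSeries ℂ) (p : Polynomial ℂ), SqSummable H →
        ∃ (H' : PowerSeries ℂ) (p' : Polynomial ℂ), SqSummable H' ∧
          Φ * ((rootsPoly s₁) * H + p) = (rootsPoly s₂) * H' + p' := by
      intro H p hH
      obtain ⟨H', p', hH', hp'⟩ := (memMbar_rootsPoly_iff s₂ hs₂).1
        (h _ ((memMbar_rootsPoly_iff s₁ hs₁).2 ⟨H, p, hH, fun _ _ => rfl⟩))
      have hc := ((convDisk_coe (rootsPoly s₁)).mul hH.convDisk).add (convDisk_coe p)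
      refine ⟨H', p', hH', (hφconv.mul hc).ext
        (((convDisk_coe _).mul hH'.convDisk).add (convDisk_coe _)) fun z hz => ?_⟩
      rw [hφconv.evalSeries_mul hc hz, ← hφev hz]
      exact hp' hz
    obtain ⟨Ψ, hΨ, hΨm⟩ := exists_multiplier_of_mul_mem s₂ hs₂ (Φ * rootsPoly s₁) fun F hF => by
      obtain ⟨H', p', hH', h'⟩ := hmul F 0 hF
      exact ⟨H', p', hH', by rw [← h']; simp [mul_assoc]⟩
    have hΨs : SqSummable Ψ := by simpa using hΨm 1 sqSummable_one
    have hΦ : Φ = κ * Ψ := by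
      refine mul_left_cancel₀ hne ?_
      rw [mul_comm, hΨ, hdivS, mul_assoc]
    obtain ⟨H, p, hH, hp⟩ := hmul 0 1 (by simpa using sqSummable_coe 0)
    have hp₁ : Φ = (rootsPoly s₂) * H + p := by simpa using hp
    have hG : SqSummable (Ψ + ((-rootsPoly s₁ : Polynomial ℂ) : PowerSeries ℂ) * H) :=
      hΨs.add (hH.coe_mul _)
    obtain ⟨Q, hQ⟩ := exists_poly_of_rootsPoly_mul s₂ hs₂ hG (rootsPoly s₁ * p) (by
      simp only [Polynomial.coe_neg, Polynomial.coe_mul]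
      linear_combination (rootsPoly s₁ : PowerSeries ℂ) * hp₁ - hΨ)
    have hΨQ : Ψ = (rootsPoly s₁) * H + Q := by
      rw [← hQ, Polynomial.coe_neg]
      ring
    refine ⟨evalSeries Ψ, (memMbar_rootsPoly_iff s₁ hs₁).2 ⟨H, Q, hH, fun z _ => by rw [hΨQ]⟩,
      ⟨hΨs.convDisk.differentiableOn, exists_bound_of_multiplier hΨm⟩, fun z hz => ?_⟩
    rw [hφev hz, hΦ, hkconv.evalSeries_mul hΨs.convDisk hz, hkev hz]
  · rintro ⟨ψ, hψM, hψ, hφψ⟩ f hf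
    obtain ⟨H, p, hH, hψH⟩ := (memMbar_rootsPoly_iff s₁ hs₁).1 hψM
    obtain ⟨H', q, hH', hfH⟩ := (memMbar_rootsPoly_iff s₁ hs₁).1 hf
    have hκs : SqSummable κ := by simpa using MemHinf.sqSummable_taylor_mul hk sqSummable_one
    obtain ⟨K, hK⟩ := exists_poly_of_rootsPoly_mul s₁ hs₁ hκs (rootsPoly s₂) hdivS.symm
    have hψc := ((convDisk_coe (rootsPoly s₁)).mul hH.convDisk).add (convDisk_coe p)
    have hfc := ((convDisk_coe (rootsPoly s₁)).mul hH'.convDisk).add (convDisk_coe q)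
    have hψt : taylor ψ = (rootsPoly s₁) * H + p := hψc.taylor_eq hψH
    refine (memMbar_rootsPoly_iff s₂ hs₂).2 ⟨taylor ψ * H' + q * H, K * p * q,
      (MemHinf.sqSummable_taylor_mul hψ hH').add (hH.coe_mul q), fun z hz => ?_⟩
    have heq : (rootsPoly s₂) * (taylor ψ * H' + q * H) +
        ((K * p * q : Polynomial ℂ) : PowerSeries ℂ) =
        κ * ((rootsPoly s₁) * H + p) * ((rootsPoly s₁) * H' + q) := by
      rw [hψt, hdivS, Polynomial.coe_mul, Polynomial.coe_mul, ← hK]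
      ring
    rw [heq, (hkconv.mul hψc).evalSeries_mul hfc hz, hkconv.evalSeries_mul hψc hz, ← hkev hz,
      ← hψH hz, ← hfH hz, ← hφψ z hz]

end Range

end Hardy

/-- for polynomials `a₁, a₂` with all zeros on the unit circle and
`k = a₂/a₁ ∈ H^∞`, one has `𝔐(ā₁, ā₂) = k·(M(ā₁) ∩ H^∞)`. -/
theorem stmt9 (N₁ N₂ : ℕ) (ζ₁ : Fin N₁ → ℂ) (ζ₂ : Fin N₂ → ℂ)
    (hζ₁ : ∀ j, ‖ζ₁ j‖ = 1) (hζ₂ : ∀ j, ‖ζ₂ j‖ = 1)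
    (k : ℂ → ℂ) (hk : MemHinf k)
    (hdiv : ∀ z ∈ unitDisk, (∏ j, (z - ζ₂ j)) = (∏ j, (z - ζ₁ j)) * k z)
    (φ : ℂ → ℂ) :
    Mult (fun z => ∏ j, (z - ζ₁ j)) (fun z => ∏ j, (z - ζ₂ j)) φ ↔
      DifferentiableOn ℂ φ unitDisk ∧
        ∃ ψ, MemMbar (fun z => ∏ j, (z - ζ₁ j)) ψ ∧ MemHinf ψ ∧
          ∀ z ∈ unitDisk, φ z = k z * ψ z := by
  have heval : ∀ (N : ℕ) (ζ : Fin N → ℂ), (fun z => ∏ j, (z - ζ j)) =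
      fun z => (Hardy.rootsPoly (Finset.univ.val.map ζ)).eval z := by
    intro N ζ
    funext z
    have h : Hardy.rootsPoly (Finset.univ.val.map ζ) =
        ∏ j, (Polynomial.X - Polynomial.C (ζ j)) := by
      rw [Hardy.rootsPoly, Multiset.map_map]
      rfl
    rw [h, Polynomial.eval_prod]
    simp
  have hnorm : ∀ (N : ℕ) (ζ : Fin N → ℂ), (∀ j, ‖ζ j‖ = 1) →
      ∀ ξ ∈ Finset.univ.val.map ζ, ‖ξ‖ = 1 := by
    intro N ζ h ξ hξ
    obtain ⟨j, -, rfl⟩ := Multiset.mem_map.1 hξ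
    exact h j
  rw [heval, heval]
  refine Hardy.mult_rootsPoly_iff _ _ (hnorm _ _ hζ₁) (hnorm _ _ hζ₂) k hk (fun z hz => ?_) φ
  rw [← congrFun (heval N₁ ζ₁) z, ← congrFun (heval N₂ ζ₂) z]
  exact hdiv z hz
end
end

section
/- Let a be a polynomial with all zeros on the unit circle. The multipliers from M(\bar{a}) to H^2 are 𝔐(\bar{a}, 1) = { φ ∈ H^2 : aφ ∈ H^∞ }. -/
open Complex Set

noncomputable section

open MeasureTheory AddCircle

/-- A function holomorphic on the unit disk is the sum of its Taylor series there. -/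
lemma hasSum_coef {f : ℂ → ℂ} (hf : DifferentiableOn ℂ f unitDisk) {z : ℂ} (hz : z ∈ unitDisk) :
    HasSum (fun n => coef f n * z ^ n) (f z) := by
  convert! Complex.hasSum_taylorSeries_on_ball hf hz using 2 with n
  simp only [coef, sub_zero, smul_eq_mul]
  ring

lemma hasFPowerSeriesOnBall_ofScalars {f : ℂ → ℂ} {c : ℕ → ℂ}
    (h : ∀ z ∈ unitDisk, HasSum (fun n => c n * z ^ n) (f z)) :
    HasFPowerSeriesOnBall f (FormalMultilinearSeries.ofScalars ℂ c) 0 1 where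
  r_le := by
    refine ENNReal.le_of_forall_nnreal_lt fun r hr => ?_
    refine FormalMultilinearSeries.le_radius_of_summable _ ?_
    have hr' : (r : ℝ) < 1 := by exact_mod_cast hr
    have := (h (r : ℂ) (by simpa [unitDisk] using hr')).summable.norm
    simpa using this
  r_pos := one_pos
  hasSum := by
    intro y hy
    have hy' : y ∈ unitDisk := by
      simpa [unitDisk, ← Metric.eball_ofReal] using hy
    simpa [FormalMultilinearSeries.ofScalars_apply_eq, mul_comm] using h y hy'

lemma differentiableOn_of_hasSum {f : ℂ → ℂ} {c : ℕ → ℂ}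
    (h : ∀ z ∈ unitDisk, HasSum (fun n => c n * z ^ n) (f z)) :
    DifferentiableOn ℂ f unitDisk := by
  have := (hasFPowerSeriesOnBall_ofScalars h).differentiableOn
  simpa [unitDisk, ← Metric.eball_ofReal] using this

/-- The coefficients of a power series converging on the unit disk are the Taylor coefficients of
its sum. -/
lemma coef_eq_of_hasSum {f : ℂ → ℂ} {c : ℕ → ℂ}
    (h : ∀ z ∈ unitDisk, HasSum (fun n => c n * z ^ n) (f z)) (n : ℕ) : coef f n = c n := by
  have h1 := (hasFPowerSeriesOnBall_ofScalars h).hasFPowerSeriesAt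
  have h2 := (hasFPowerSeriesOnBall_ofScalars
    fun z hz => hasSum_coef (differentiableOn_of_hasSum h) hz).hasFPowerSeriesAt
  simpa using congrArg (fun p => p.coeff n) (h2.eq_formalMultilinearSeries h1)

lemma coef_congr {f g : ℂ → ℂ} (h : Set.EqOn f g unitDisk) (n : ℕ) : coef f n = coef g n := by
  have : f =ᶠ[nhds 0] g :=
    h.eventuallyEq_of_mem (Metric.ball_mem_nhds _ one_pos)
  rw [coef, coef, this.iteratedDeriv_eq]

lemma coef_add {f g : ℂ → ℂ} (hf : DifferentiableOn ℂ f unitDisk)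
    (hg : DifferentiableOn ℂ g unitDisk) (n : ℕ) :
    coef (fun z => f z + g z) n = coef f n + coef g n :=
  coef_eq_of_hasSum (c := fun n => coef f n + coef g n)
    (fun z hz => by simpa [add_mul] using (hasSum_coef hf hz).add (hasSum_coef hg hz)) n

lemma coef_const_mul {f : ℂ → ℂ} (hf : DifferentiableOn ℂ f unitDisk) (c : ℂ) (n : ℕ) :
    coef (fun z => c * f z) n = c * coef f n :=
  coef_eq_of_hasSum (c := fun n => c * coef f n)
    (fun z hz => by simpa [mul_assoc] using (hasSum_coef hf hz).mul_left c) n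

lemma coef_mul {f g : ℂ → ℂ} (hf : DifferentiableOn ℂ f unitDisk)
    (hg : DifferentiableOn ℂ g unitDisk) (n : ℕ) :
    coef (fun z => f z * g z) n =
      ∑ p ∈ Finset.HasAntidiagonal.antidiagonal n, coef f p.1 * coef g p.2 := by
  refine coef_eq_of_hasSum
    (c := fun n => ∑ p ∈ Finset.HasAntidiagonal.antidiagonal n, coef f p.1 * coef g p.2) (fun z hz => ?_) n
  have h1 := hasSum_coef hf hz
  have h2 := hasSum_coef hg hz
  have h := tsum_mul_tsum_eq_tsum_sum_antidiagonal_of_summable_norm h1.summable.norm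
    h2.summable.norm
  have hs := (summable_norm_sum_mul_antidiagonal_of_summable_norm h1.summable.norm
    h2.summable.norm).of_norm.hasSum
  rw [← h, h1.tsum_eq, h2.tsum_eq] at hs
  convert! hs using 2 with m
  rw [Finset.sum_mul]
  refine Finset.sum_congr rfl fun p hp => ?_
  rw [← Finset.HasAntidiagonal.mem_antidiagonal.1 hp, pow_add]
  ring

lemma coef_eval (p : Polynomial ℂ) (n : ℕ) : coef (fun z => p.eval z) n = p.coeff n := by
  refine coef_eq_of_hasSum (c := p.coeff) (fun z _ => ?_) n
  rw [p.eval_eq_sum_range]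
  refine hasSum_sum_of_ne_finset_zero fun k hk => ?_
  rw [Polynomial.coeff_eq_zero_of_natDegree_lt (by simpa using hk), zero_mul]

lemma MemH2.congr {f g : ℂ → ℂ} (hf : MemH2 f) (h : Set.EqOn g f unitDisk) : MemH2 g :=
  ⟨hf.1.congr h, by simpa only [coef_congr h] using hf.2⟩

lemma memℓp_two_iff {c : ℕ → ℂ} : Memℓp c 2 ↔ Summable fun n => ‖c n‖ ^ 2 := by
  rw [memℓp_gen_iff (by norm_num)]
  simp

lemma MemH2.memℓp {f : ℂ → ℂ} (hf : MemH2 f) : Memℓp (coef f) 2 := memℓp_two_iff.2 hf.2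

lemma summable_mul_pow_of_memℓp {c : ℕ → ℂ} (hc : Memℓp c 2) {z : ℂ} (hz : z ∈ unitDisk) :
    Summable fun n => c n * z ^ n := by
  have hz' : ‖z‖ < 1 := by simpa [unitDisk] using hz
  obtain ⟨C, hC⟩ := memℓp_infty_iff.1 (hc.of_exponent_ge le_top)
  refine Summable.of_norm_bounded
    ((summable_geometric_of_lt_one (norm_nonneg z) hz').mul_left C) fun n => ?_
  rw [norm_mul, norm_pow]
  gcongr
  exact hC ⟨n, rfl⟩

/-- A square-summable sequence is the coefficient sequence of an `H²` function. -/
lemma memH2_of_hasSum {f : ℂ → ℂ} {c : ℕ → ℂ} (hc : Memℓp c 2)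
    (h : ∀ z ∈ unitDisk, HasSum (fun n => c n * z ^ n) (f z)) : MemH2 f :=
  ⟨differentiableOn_of_hasSum h, by
    simpa only [coef_eq_of_hasSum h] using memℓp_two_iff.1 hc⟩

lemma MemH2.add {f g : ℂ → ℂ} (hf : MemH2 f) (hg : MemH2 g) : MemH2 fun z => f z + g z :=
  memH2_of_hasSum (hf.memℓp.add hg.memℓp) fun z hz => by
    simpa [add_mul] using (hasSum_coef hf.1 hz).add (hasSum_coef hg.1 hz)

/-- Parseval's identity for an absolutely convergent power series on a circle. -/
lemma hasSum_sq_norm_of_hasSum_fourier {c : ℕ → ℂ} (hc : Summable fun n => ‖c n‖)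
    {f : C(AddCircle (1 : ℝ), ℂ)} (hf : ∀ t, HasSum (fun n : ℕ => c n * fourier n t) (f t)) :
    HasSum (fun n => ‖c n‖ ^ 2) (∫ t, ‖f t‖ ^ 2 ∂haarAddCircle) := by
  have hs : HasSum (fun n : ℕ => c n • (fourier n : C(AddCircle (1 : ℝ), ℂ))) f := by
    have h : Summable (fun n : ℕ => c n • (fourier n : C(AddCircle (1 : ℝ), ℂ))) := by
      refine Summable.of_norm ?_
      simpa only [norm_smul, fourier_norm, mul_one] using hc
    convert h.hasSum
    ext t
    refine (hf t).unique ?_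
    simpa using (ContinuousMap.evalCLM ℂ t).hasSum h.hasSum
  set F := ContinuousMap.toLp (E := ℂ) 2 haarAddCircle ℂ f with hF
  have hs2 : HasSum (fun n : ℕ => c n • fourierLp (T := (1 : ℝ)) 2 n) F := by
    simpa using (ContinuousMap.toLp (E := ℂ) 2 haarAddCircle ℂ).hasSum hs
  have hcoef (k : ℤ) : HasSum (fun n : ℕ => c n * (if k = n then 1 else 0)) (fourierCoeff F k) := by
    rw [← fourierBasis_repr, HilbertBasis.repr_apply_apply, coe_fourierBasis]
    convert! (innerSL ℂ (fourierLp (T := (1 : ℝ)) 2 k)).hasSum hs2 using 2 with n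
    simp only [innerSL_apply_apply, inner_smul_right]
    rw [(orthonormal_iff_ite.1 (orthonormal_fourier (T := (1 : ℝ)))) k n]
  have hsq := hasSum_sq_fourierCoeff F
  have hint : ∫ t, ‖F t‖ ^ 2 ∂haarAddCircle = ∫ t, ‖f t‖ ^ 2 ∂haarAddCircle := by
    refine integral_congr_ae ?_
    filter_upwards [ContinuousMap.coeFn_toLp (p := 2) (𝕜 := ℂ) haarAddCircle f] with t ht
    rw [hF, ht]
  rw [hint] at hsq
  rw [← (Nat.cast_injective (R := ℤ)).hasSum_iff] at hsq
  · convert! hsq using 2 with n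
    have := hcoef n
    simp only [Nat.cast_inj] at this
    simp only [Function.comp]
    have h : HasSum (fun m => c m * (if n = m then 1 else 0)) (c n) := by
      convert! hasSum_ite_eq n (c n) using 2 with m
      aesop
    rw [this.unique h]
  · intro k hk
    have : fourierCoeff F k = 0 := by
      refine (hcoef k).unique ?_
      convert hasSum_zero with n
      simp only [mul_ite, mul_one, mul_zero, ite_eq_right_iff]
      rintro rfl
      exact absurd ⟨n, rfl⟩ hk
    simp [this]

lemma mul_fourier_one_mem_unitDisk {r : ℝ} (hr0 : 0 ≤ r) (hr1 : r < 1) (t : AddCircle (1 : ℝ)) :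
    (r : ℂ) * fourier 1 t ∈ unitDisk := by
  rw [unitDisk, mem_ball_zero_iff, norm_mul, fourier_one, Circle.norm_coe, mul_one, norm_real,
    Real.norm_of_nonneg hr0]
  exact hr1

lemma continuous_comp_mul_fourier_one {g : ℂ → ℂ} (hg : DifferentiableOn ℂ g unitDisk) {r : ℝ}
    (hr0 : 0 ≤ r) (hr1 : r < 1) :
    Continuous fun t : AddCircle (1 : ℝ) => g (r * fourier 1 t) :=
  hg.continuousOn.comp_continuous (by fun_prop) (mul_fourier_one_mem_unitDisk hr0 hr1)

lemma hasSum_sq_norm_coef_mul_pow {g : ℂ → ℂ} (hg : DifferentiableOn ℂ g unitDisk) {r : ℝ}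
    (hr0 : 0 ≤ r) (hr1 : r < 1) :
    HasSum (fun n => ‖coef g n * (r : ℂ) ^ n‖ ^ 2)
      (∫ t : AddCircle (1 : ℝ), ‖g (r * fourier 1 t)‖ ^ 2 ∂haarAddCircle) := by
  have hr : (r : ℂ) ∈ unitDisk := by simpa [unitDisk, abs_of_nonneg hr0] using hr1
  refine hasSum_sq_norm_of_hasSum_fourier (f := ⟨_, continuous_comp_mul_fourier_one hg hr0 hr1⟩)
    (hasSum_coef hg hr).summable.norm fun t => ?_
  convert! hasSum_coef hg (mul_fourier_one_mem_unitDisk hr0 hr1 t) using 2 with n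
  have : fourier (T := (1 : ℝ)) n t = fourier 1 t ^ n := by
    simp [fourier_apply, toCircle_nsmul]
  rw [this, mul_pow, mul_assoc]

lemma integral_sq_norm_le_of_forall_norm_le {f g : AddCircle (1 : ℝ) → ℂ} (hf : Continuous f)
    (hg : Continuous g) {C : ℝ} (hfg : ∀ t, ‖f t‖ ≤ C * ‖g t‖) :
    ∫ t, ‖f t‖ ^ 2 ∂haarAddCircle ≤ C ^ 2 * ∫ t, ‖g t‖ ^ 2 ∂haarAddCircle := by
  have hint {u : AddCircle (1 : ℝ) → ℂ} (hu : Continuous u) :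
      Integrable (fun t => ‖u t‖ ^ 2) haarAddCircle :=
    (hu.norm.pow 2).integrable_of_hasCompactSupport (HasCompactSupport.of_compactSpace _)
  rw [← integral_const_mul]
  refine integral_mono (hint hf) ((hint hg).const_mul _) fun t => ?_
  change ‖f t‖ ^ 2 ≤ C ^ 2 * ‖g t‖ ^ 2
  rw [← mul_pow]
  exact pow_le_pow_left₀ (norm_nonneg _) (hfg t) 2

/-- Multiplication by an `H^∞` function preserves `H²`. -/
lemma MemHinf.mul_memH2 {ψ h : ℂ → ℂ} (hψ : MemHinf ψ) (hh : MemH2 h) :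
    MemH2 fun z => ψ z * h z := by
  obtain ⟨hψd, C, hC⟩ := hψ
  have hd : DifferentiableOn ℂ (fun z => ψ z * h z) unitDisk := hψd.mul hh.1
  refine ⟨hd, ?_⟩
  refine summable_of_sum_le (c := C ^ 2 * ∑' n, ‖coef h n‖ ^ 2) (fun _ => by positivity)
    fun s => ?_
  have hbound (r : ℝ) (hr : r ∈ Ioo (0 : ℝ) 1) :
      ∑ n ∈ s, ‖coef (fun z => ψ z * h z) n * (r : ℂ) ^ n‖ ^ 2 ≤
        C ^ 2 * ∑' n, ‖coef h n‖ ^ 2 := by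
    have h1 := hasSum_sq_norm_coef_mul_pow hd hr.1.le hr.2
    have h2 := hasSum_sq_norm_coef_mul_pow hh.1 hr.1.le hr.2
    have hle1 := integral_sq_norm_le_of_forall_norm_le
      (continuous_comp_mul_fourier_one hd hr.1.le hr.2)
      (continuous_comp_mul_fourier_one hh.1 hr.1.le hr.2) (C := C) fun t => by
        rw [norm_mul]
        exact mul_le_mul_of_nonneg_right (hC _ (mul_fourier_one_mem_unitDisk hr.1.le hr.2 t))
          (norm_nonneg _)
    have hle2 : ∑' n, ‖coef h n * (r : ℂ) ^ n‖ ^ 2 ≤ ∑' n, ‖coef h n‖ ^ 2 := by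
      refine h2.summable.tsum_le_tsum (fun n => ?_) hh.2
      rw [norm_mul, norm_pow, norm_real, Real.norm_of_nonneg hr.1.le]
      exact pow_le_pow_left₀ (mul_nonneg (norm_nonneg _) (pow_nonneg hr.1.le n))
        (mul_le_of_le_one_right (norm_nonneg _) (pow_le_one₀ hr.1.le hr.2.le)) 2
    rw [h2.tsum_eq] at hle2
    exact (sum_le_hasSum s (fun _ _ => sq_nonneg _) h1).trans
      (hle1.trans (mul_le_mul_of_nonneg_left hle2 (sq_nonneg C)))
  have hlim : Filter.Tendsto
      (fun r : ℝ => ∑ n ∈ s, ‖coef (fun z => ψ z * h z) n * (r : ℂ) ^ n‖ ^ 2)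
      (nhdsWithin 1 (Iio 1)) (nhds (∑ n ∈ s, ‖coef (fun z => ψ z * h z) n‖ ^ 2)) := by
    have hc : Continuous
        fun r : ℝ => ∑ n ∈ s, ‖coef (fun z => ψ z * h z) n * (r : ℂ) ^ n‖ ^ 2 := by fun_prop
    simpa using (hc.tendsto 1).mono_left nhdsWithin_le_nhds
  refine le_of_tendsto hlim ?_
  filter_upwards [Ioo_mem_nhdsLT (zero_lt_one' ℝ)] with r hr using hbound r hr

lemma memHinf_eval (p : Polynomial ℂ) : MemHinf fun z => p.eval z := by
  refine ⟨p.differentiable.differentiableOn, ?_⟩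
  obtain ⟨C, hC⟩ := (isCompact_closedBall (0 : ℂ) 1).exists_bound_of_continuousOn
    p.continuous.continuousOn
  exact ⟨C, fun z hz => hC z (Metric.ball_subset_closedBall hz)⟩

/-- The function on the disk with a given coefficient sequence. -/
def powerSum (x : ℕ → ℂ) (z : ℂ) : ℂ := ∑' n, x n * z ^ n

lemma hasSum_powerSum {x : ℕ → ℂ} (hx : Memℓp x 2) {z : ℂ} (hz : z ∈ unitDisk) :
    HasSum (fun n => x n * z ^ n) (powerSum x z) :=
  (summable_mul_pow_of_memℓp hx hz).hasSum

lemma memH2_powerSum {x : ℕ → ℂ} (hx : Memℓp x 2) : MemH2 (powerSum x) :=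
  memH2_of_hasSum hx fun _ => hasSum_powerSum hx

lemma coef_powerSum {x : ℕ → ℂ} (hx : Memℓp x 2) (n : ℕ) : coef (powerSum x) n = x n :=
  coef_eq_of_hasSum (fun _ => hasSum_powerSum hx) n

/-- Evaluation at a point of the disk, as a functional on square-summable coefficient sequences. -/
lemma exists_clm_eq_powerSum {z : ℂ} (hz : z ∈ unitDisk) :
    ∃ L : lp (fun _ : ℕ => ℂ) 2 →L[ℂ] ℂ, ∀ x, L x = powerSum x z := by
  have hk : Memℓp (fun n => (starRingEnd ℂ) z ^ n) 2 := by
    have hz' : ‖z‖ < 1 := by simpa [unitDisk] using hz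
    rw [memℓp_two_iff]
    have : Summable fun n => (‖z‖ ^ 2) ^ n :=
      summable_geometric_of_lt_one (by positivity) (by nlinarith [norm_nonneg z])
    simpa [← pow_mul, mul_comm] using this
  refine ⟨innerSL ℂ (⟨_, hk⟩ : lp (fun _ : ℕ => ℂ) 2), fun x => ?_⟩
  rw [innerSL_apply_apply, lp.inner_eq_tsum]
  simp [powerSum]

/-- A multiplier of `H²` is bounded. -/
lemma memHinf_of_forall_mul_memH2 {ψ : ℂ → ℂ} (hψ : DifferentiableOn ℂ ψ unitDisk)
    (h : ∀ f, MemH2 f → MemH2 fun z => ψ z * f z) : MemHinf ψ := by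
  let T : lp (fun _ : ℕ => ℂ) 2 →ₗ[ℂ] lp (fun _ : ℕ => ℂ) 2 :=
    { toFun := fun x =>
        ⟨coef fun z => ψ z * powerSum x z, (h _ (memH2_powerSum (lp.memℓp x))).memℓp⟩
      map_add' := fun x y => by
        ext n
        simp only [lp.coeFn_add, Pi.add_apply]
        rw [coef_mul hψ (memH2_powerSum ((lp.memℓp x).add (lp.memℓp y))).1,
          coef_mul hψ (memH2_powerSum (lp.memℓp x)).1, coef_mul hψ (memH2_powerSum (lp.memℓp y)).1,
          ← Finset.sum_add_distrib]
        refine Finset.sum_congr rfl fun p _ => ?_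
        rw [coef_powerSum ((lp.memℓp x).add (lp.memℓp y)), coef_powerSum (lp.memℓp x),
          coef_powerSum (lp.memℓp y), Pi.add_apply, mul_add]
      map_smul' := fun c x => by
        ext n
        simp only [lp.coeFn_smul, Pi.smul_apply, RingHom.id_apply]
        rw [coef_mul hψ (memH2_powerSum ((lp.memℓp x).const_smul c)).1,
          coef_mul hψ (memH2_powerSum (lp.memℓp x)).1, Finset.smul_sum]
        refine Finset.sum_congr rfl fun p _ => ?_
        rw [coef_powerSum ((lp.memℓp x).const_smul c), coef_powerSum (lp.memℓp x), Pi.smul_apply,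
          mul_smul_comm] }
  have hT (x : lp (fun _ : ℕ => ℂ) 2) (n : ℕ) :
      T x n = ∑ p ∈ Finset.HasAntidiagonal.antidiagonal n, coef ψ p.1 * x p.2 := by
    change coef (fun z => ψ z * powerSum x z) n = _
    rw [coef_mul hψ (memH2_powerSum (lp.memℓp x)).1]
    simp only [coef_powerSum (lp.memℓp x)]
  have heval (n : ℕ) : Continuous fun x : lp (fun _ : ℕ => ℂ) 2 => x n :=
    (lp.lipschitzWith_one_eval 2 n).continuous
  have hcont : Continuous T := by
    refine T.continuous_of_seq_closed_graph fun u x y hu hTu => ?_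
    ext n
    refine tendsto_nhds_unique (((heval n).tendsto y).comp hTu) ?_
    simp only [Function.comp_def, hT]
    exact tendsto_finsetSum _ fun p _ =>
      (((heval p.2).tendsto x).comp hu).const_mul (coef ψ p.1)
  let S : lp (fun _ : ℕ => ℂ) 2 →L[ℂ] lp (fun _ : ℕ => ℂ) 2 := ⟨T, hcont⟩
  refine ⟨hψ, ‖S‖, fun z hz => ?_⟩
  obtain ⟨L, hL⟩ := exists_clm_eq_powerSum hz
  have hLS : L.comp S = ψ z • L := by
    ext1 x
    have hx := h _ (memH2_powerSum (lp.memℓp x))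
    change L (T x) = ψ z * L x
    rw [hL, hL]
    exact (hasSum_coef hx.1 hz).tsum_eq
  have hL0 : L ≠ 0 := by
    intro h0
    have h1 := hL (lp.single 2 0 1)
    rw [h0, powerSum, tsum_eq_single 0 (fun n hn => by simp [hn])] at h1
    simp at h1
  have hle := L.opNorm_comp_le S
  rw [hLS, norm_smul, mul_comm] at hle
  exact le_of_mul_le_mul_left hle (norm_pos_iff.2 hL0)

open Polynomial in
/-- A polynomial with all zeros on the unit circle is self-inversive up to a constant. -/
lemma exists_conj_coeff_prod_eq {N : ℕ} (ζ : Fin N → ℂ) (hζ : ∀ j, ‖ζ j‖ = 1) :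
    ∃ c : ℂ, c ≠ 0 ∧ ∀ k ≤ N, (starRingEnd ℂ) ((∏ j, (X - C (ζ j))).coeff k) =
      c * (∏ j, (X - C (ζ j))).coeff (N - k) := by
  have hne (j : Fin N) : ζ j ≠ 0 := fun h => by simpa [h] using hζ j
  have hrev : ∀ s : Finset (Fin N), ((∏ j ∈ s, (X - C (ζ j))).map (starRingEnd ℂ)).reverse =
      C (∏ j ∈ s, -(ζ j)⁻¹) * ∏ j ∈ s, (X - C (ζ j)) := by
    intro s
    induction s using Finset.induction_on with
    | empty => simpa using reverse_C (1 : ℂ)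
    | insert i s hi ih =>
      rw [Finset.prod_insert hi, Finset.prod_insert hi, Polynomial.map_mul,
        reverse_mul_of_domain, ih, C_mul]
      have h1 : ((X - C (ζ i)).map (starRingEnd ℂ)).reverse =
          C (-(ζ i)⁻¹) * (X - C (ζ i)) := by
        have hc : (starRingEnd ℂ) (ζ i) = (ζ i)⁻¹ := by
          rw [Complex.inv_eq_conj (hζ i)]
        rw [Polynomial.map_sub, map_X, map_C, hc, sub_eq_add_neg, ← C_neg, reverse_add_C]
        have : C (-(ζ i)⁻¹) * C (ζ i) = (-1 : ℂ[X]) := by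
          rw [← C_mul, neg_mul, inv_mul_cancel₀ (hne i), C_neg, C_1]
        rw [mul_sub, this]
        have hX : (X : ℂ[X]).reverse = 1 := by
          simpa [show reverse (1 : ℂ[X]) = 1 by simpa using reverse_C (1 : ℂ)] using
            reverse_mul_X (1 : ℂ[X])
        simp [hX]
        ring
      rw [h1]
      ring
  refine ⟨∏ j, -(ζ j)⁻¹, Finset.prod_ne_zero_iff.2 fun j _ => by simpa using hne j,
    fun k hk => ?_⟩
  have hdeg : ((∏ j, (X - C (ζ j))).map (starRingEnd ℂ)).natDegree = N := by
    rw [natDegree_map]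
    simp
  have := congrArg (fun p => p.coeff (N - k)) (hrev Finset.univ)
  simp only [coeff_reverse, hdeg, coeff_C_mul] at this
  rw [← this, revAt_le (Nat.sub_le _ _), Nat.sub_sub_self hk, coeff_map]

/-- For a self-inversive polynomial, the co-analytic Toeplitz operator is, up to a constant, a
shifted multiplication operator. -/
lemma tsum_conj_coef_mul_coef {p : Polynomial ℂ} {N : ℕ} (hp : p.natDegree ≤ N) {c : ℂ}
    (hc : ∀ k ≤ N, (starRingEnd ℂ) (p.coeff k) = c * p.coeff (N - k)) {g : ℂ → ℂ}
    (hg : DifferentiableOn ℂ g unitDisk) (n : ℕ) :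
    ∑' k, (starRingEnd ℂ) (coef (fun z => p.eval z) k) * coef g (n + k) =
      c * coef (fun z => p.eval z * g z) (n + N) := by
  rw [coef_mul (memHinf_eval p).1 hg, Finset.Nat.sum_antidiagonal_eq_sum_range_succ_mk]
  simp only [coef_eval]
  have h0 (k : ℕ) (hk : N < k) : p.coeff k = 0 :=
    Polynomial.coeff_eq_zero_of_natDegree_lt (hp.trans_lt hk)
  rw [tsum_eq_sum (s := Finset.range (N + 1)) fun k hk => by
      rw [h0 k (by simpa using hk), map_zero, zero_mul],
    ← Finset.sum_subset (s₁ := Finset.range (N + 1)) (s₂ := Finset.range (n + N).succ) (by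
      intro k; simp only [Finset.mem_range]; omega)
      (f := fun k => p.coeff k * coef g (n + N - k)) fun k _ hk => by
        rw [h0 k (by simpa using hk), zero_mul],
    ← Finset.sum_range_reflect, Finset.mul_sum]
  refine Finset.sum_congr rfl fun k hk => ?_
  have hk' : k ≤ N := by simpa [Nat.lt_succ_iff] using hk
  rw [Nat.add_sub_cancel, hc _ (Nat.sub_le _ _), Nat.sub_sub_self hk', mul_assoc,
    Nat.add_sub_assoc hk']

lemma MemH2.const_mul {f : ℂ → ℂ} (hf : MemH2 f) (c : ℂ) : MemH2 fun z => c * f z := by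
  simpa using (memHinf_eval (Polynomial.C c)).mul_memH2 hf

lemma coef_pow_mul_add {f : ℂ → ℂ} (hf : DifferentiableOn ℂ f unitDisk) (N n : ℕ) :
    coef (fun z => z ^ N * f z) (n + N) = coef f n := by
  have hX (k : ℕ) : coef (fun z => z ^ N) k = if k = N then 1 else 0 := by
    simpa [Polynomial.coeff_X_pow] using coef_eval (Polynomial.X ^ N) k
  rw [coef_mul (by fun_prop) hf, Finset.sum_eq_single (N, n)]
  · simp [hX]
  · rintro ⟨i, j⟩ hij hne
    rw [Finset.HasAntidiagonal.mem_antidiagonal] at hij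
    have : i ≠ N := by
      rintro rfl
      exact hne (by ext <;> simp; simp at hij; omega)
    simp [hX, this]
  · intro h
    exact absurd (Finset.HasAntidiagonal.mem_antidiagonal.2 (add_comm N n)) h

/-- `M(ā)` contains `a H²`. -/
lemma memMbar_mul {p : Polynomial ℂ} {N : ℕ} (hp : p.natDegree ≤ N) {c : ℂ} (hc0 : c ≠ 0)
    (hc : ∀ k ≤ N, (starRingEnd ℂ) (p.coeff k) = c * p.coeff (N - k)) {h : ℂ → ℂ}
    (hh : MemH2 h) : MemMbar (fun z => p.eval z) fun z => p.eval z * h z := by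
  have hg : MemH2 fun z => z ^ N * (c⁻¹ * h z) := by
    simpa using (memHinf_eval (Polynomial.X ^ N)).mul_memH2 (hh.const_mul c⁻¹)
  have hph : DifferentiableOn ℂ (fun z => p.eval z * h z) unitDisk :=
    ((memHinf_eval p).mul_memH2 hh).1
  refine ⟨_, hg, fun z hz => ?_⟩
  refine (hasSum_coef hph hz).tsum_eq.symm.trans ?_
  rw [Tbar]
  refine tsum_congr fun n => ?_
  rw [tsum_conj_coef_mul_coef hp hc hg.1]
  have : (fun z => p.eval z * (z ^ N * (c⁻¹ * h z))) =
      fun z => z ^ N * (c⁻¹ * (p.eval z * h z)) := by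
    ext z; ring
  rw [this, coef_pow_mul_add (hph.const_mul c⁻¹), coef_const_mul hph, mul_inv_cancel_left₀ hc0]

/-- `M(ā)` contains the constants. -/
lemma memMbar_one {p : Polynomial ℂ} {N : ℕ} (hp : p.natDegree = N) (hm : p.Monic) {c : ℂ}
    (hc0 : c ≠ 0) (hc : ∀ k ≤ N, (starRingEnd ℂ) (p.coeff k) = c * p.coeff (N - k)) :
    MemMbar (fun z => p.eval z) fun _ => 1 := by
  have h1 : MemH2 fun _ => c⁻¹ := by
    refine ⟨differentiableOn_const _, ?_⟩
    have (n : ℕ) : coef (fun _ => c⁻¹) n = (Polynomial.C c⁻¹).coeff n := by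
      simpa using coef_eval (Polynomial.C c⁻¹) n
    simp only [this]
    refine summable_of_ne_finset_zero (s := {0}) fun n hn => ?_
    rw [Polynomial.coeff_C_of_ne_zero (by simpa using hn)]
    simp
  refine ⟨_, h1, fun z hz => ?_⟩
  rw [Tbar]
  simp only [tsum_conj_coef_mul_coef hp.le hc h1.1]
  have (n : ℕ) : c * coef (fun z => p.eval z * c⁻¹) (n + N) = p.coeff (n + N) := by
    have := coef_eval (p * Polynomial.C c⁻¹) (n + N)
    simp only [Polynomial.eval_mul, Polynomial.eval_C, Polynomial.coeff_mul_C] at this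
    rw [this]
    field_simp
  simp only [this]
  rw [tsum_eq_single 0]
  · simp [← hp, hm.coeff_natDegree]
  · intro n hn
    rw [Polynomial.coeff_eq_zero_of_natDegree_lt (by omega), zero_mul]

/-- Every element of `M(ā)` is the sum of an element of `a H²` and a polynomial. -/
lemma exists_eq_mul_add_eval_of_memMbar {p : Polynomial ℂ} {N : ℕ} (hp : p.natDegree ≤ N)
    (hp0 : p.coeff 0 ≠ 0) {c : ℂ}
    (hc : ∀ k ≤ N, (starRingEnd ℂ) (p.coeff k) = c * p.coeff (N - k)) {f : ℂ → ℂ}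
    (hf : MemMbar (fun z => p.eval z) f) :
    ∃ h, MemH2 h ∧ ∃ q : Polynomial ℂ,
      Set.EqOn f (fun z => p.eval z * h z + q.eval z) unitDisk := by
  obtain ⟨g, hg, hfg⟩ := hf
  have hpg : MemH2 fun z => p.eval z * g z := (memHinf_eval p).mul_memH2 hg
  let b : ℕ → ℂ := coef fun z => p.eval z * g z
  have hb : Memℓp (fun n => c * b (n + N)) 2 := by
    refine Memℓp.const_mul (f := fun n => b (n + N)) (memℓp_two_iff.2 ?_) c
    exact (summable_nat_add_iff N).2 hpg.2
  have hfb : Set.EqOn f (powerSum fun n => c * b (n + N)) unitDisk := by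
    intro z hz
    rw [hfg hz, Tbar, powerSum]
    refine tsum_congr fun n => ?_
    rw [tsum_conj_coef_mul_coef hp hc hg.1]
  have hf2 : MemH2 f := (memH2_powerSum hb).congr hfb
  let r : Polynomial ℂ :=
    ∑ i ∈ Finset.range N, Polynomial.C (c * b i) * Polynomial.X ^ i
  have hshift (z : ℂ) (hz : z ∈ unitDisk) :
      z ^ N * f z = c * (p.eval z * g z) - r.eval z := by
    have hs := hasSum_coef hpg.1 hz
    rw [hfb hz, powerSum, ← hs.tsum_eq, ← hs.summable.sum_add_tsum_nat_add N, mul_add,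
      ← tsum_mul_left, ← tsum_mul_left, Finset.mul_sum]
    simp only [r, Polynomial.eval_finsetSum, Polynomial.eval_mul, Polynomial.eval_C,
      Polynomial.eval_pow, Polynomial.eval_X, mul_assoc]
    rw [add_sub_cancel_left]
    refine tsum_congr fun n => ?_
    simp only [b]
    ring
  obtain ⟨u, v, huv⟩ : IsCoprime (Polynomial.X ^ N) p :=
    ((Polynomial.irreducible_X.coprime_iff_not_dvd).2
      (by rwa [Polynomial.X_dvd_iff])).pow_left
  refine ⟨fun z => (u * Polynomial.C c).eval z * g z + v.eval z * f z,
    ((memHinf_eval _).mul_memH2 hg).add ((memHinf_eval _).mul_memH2 hf2), -(u * r),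
    fun z hz => ?_⟩
  have h1 := congrArg (Polynomial.eval z) huv
  simp only [Polynomial.eval_add, Polynomial.eval_mul, Polynomial.eval_pow, Polynomial.eval_X,
    Polynomial.eval_one] at h1
  simp only [Polynomial.eval_mul, Polynomial.eval_C, Polynomial.eval_neg]
  linear_combination u.eval z * hshift z hz - f z * h1

/-- for a polynomial `a` with all zeros on the unit circle, the
multipliers from `M(ā)` to `H²` are `𝔐(ā, 1) = {φ ∈ H² : aφ ∈ H^∞}`. -/
theorem stmt10 (N : ℕ) (ζ : Fin N → ℂ) (hζ : ∀ j, ‖ζ j‖ = 1) (φ : ℂ → ℂ) :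
    (DifferentiableOn ℂ φ unitDisk ∧
        ∀ f, MemMbar (fun z => ∏ j, (z - ζ j)) f → MemH2 fun z => φ z * f z) ↔
      MemH2 φ ∧ MemHinf fun z => (∏ j, (z - ζ j)) * φ z := by
  obtain ⟨c, hc0, hc⟩ := exists_conj_coeff_prod_eq ζ hζ
  set p : Polynomial ℂ := ∏ j, (Polynomial.X - Polynomial.C (ζ j)) with hpdef
  have hp : p.natDegree = N := by simp [hpdef]
  have hm : p.Monic := Polynomial.monic_prod_X_sub_C _ _
  have heval (z : ℂ) : ∏ j, (z - ζ j) = p.eval z := by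
    simp [hpdef, Polynomial.eval_prod]
  have hp0 : p.coeff 0 ≠ 0 := by
    have h := hc 0 (Nat.zero_le N)
    rw [Nat.sub_zero, ← hp, hm.coeff_natDegree, mul_one] at h
    intro h0
    rw [h0, map_zero] at h
    exact hc0 h.symm
  simp only [heval]
  constructor
  · rintro ⟨hφ, hmul⟩
    refine ⟨by simpa using hmul _ (memMbar_one hp hm hc0 hc), ?_⟩
    refine memHinf_of_forall_mul_memH2 ((memHinf_eval p).1.mul hφ) fun h hh => ?_
    exact (hmul _ (memMbar_mul hp.le hc0 hc hh)).congr fun z _ => by ring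
  · rintro ⟨hφ, hpφ⟩
    refine ⟨hφ.1, fun f hf => ?_⟩
    obtain ⟨h, hh, q, hfq⟩ := exists_eq_mul_add_eval_of_memMbar hp.le hp0 hc hf
    refine ((hpφ.mul_memH2 hh).add ((memHinf_eval q).mul_memH2 hφ)).congr fun z hz => ?_
    simp only [hfq hz]
    ring
end
end
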